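/- There exist constants c₁, c₂ > 0 such that for every integer a ≥ 8 for which the ring of integers of the simplest cubic field K_a equals ℤ[ρ], and for every real number x ≥ 1, one has c₁·((log a)²·x/a² + (x/a)^(2/3) + x^(1/3)) ≤ P(a, x) ≤ c₂·((log a)²·x/a² + (x/a)^(2/3) + x^(1/3)). -/

import Mathlib

open NumberField

/-- The largest real root of `X³ - aX² - (a+3)X - 1` (for `a ≥ 7` this set of real roots
is nonempty and bounded above, so `sSup` picks out the largest root). -/
noncomputable def simplestCubicRoot (a : ℤ) : ℝ :=
  sSup {x : ℝ | x ^ 3 - (a : ℝ) * x ^ 2 - ((a : ℝ) + 3) * x - 1 = 0}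

namespace SimplestCubic

/-- The three conjugate real roots `r > 0 > s > t` of `X³ - aX² - (a+3)X - 1`. -/
structure RootTriple (a r s t : ℝ) : Prop where
  eight_le : 8 ≤ a
  lt_r : a + 1 < r
  r_lt : r < a + 2
  root : r ^ 3 - a * r ^ 2 - (a + 3) * r - 1 = 0
  s_mul : s * (r + 1) = -1
  t_mul : t * r = -(r + 1)

namespace RootTriple

variable {a r s t : ℝ}

lemma r_pos (h : RootTriple a r s t) : 0 < r := by
  have := h.eight_le; have := h.lt_r; linarith

lemma s_eq (h : RootTriple a r s t) : s = -1 / (r + 1) := by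
  have := h.r_pos
  rw [eq_div_iff (by positivity)]; exact h.s_mul

lemma t_eq (h : RootTriple a r s t) : t = -(r + 1) / r := by
  have := h.r_pos
  rw [eq_div_iff (by positivity)]; exact h.t_mul

lemma s_neg (h : RootTriple a r s t) : s < 0 := by
  have := h.r_pos
  rw [h.s_eq]
  exact div_neg_of_neg_of_pos (by norm_num) (by positivity)

lemma neg_s_mul_lt (h : RootTriple a r s t) : -s * (a + 2) < 1 := by
  have h1 := h.s_neg
  have h2 := h.s_mul
  have h3 := h.lt_r
  nlinarith

lemma neg_s_lt (h : RootTriple a r s t) : -s < 1 / 10 := by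
  have h1 := h.s_neg
  have h2 := h.neg_s_mul_lt
  have h3 := h.eight_le
  nlinarith

lemma t_lt (h : RootTriple a r s t) : t < -1 := by
  have h1 := h.r_pos
  have h2 := h.t_mul
  nlinarith

lemma lt_t (h : RootTriple a r s t) : -(10 / 9) < t := by
  have h1 := h.t_lt
  have h2 := h.t_mul
  have h3 := h.lt_r
  have h4 := h.eight_le
  nlinarith

lemma sum_eq (h : RootTriple a r s t) : r + s + t = a := by
  have h1 := h.r_pos
  have h2 := h.root
  rw [h.s_eq, h.t_eq]
  field_simp
  linarith

lemma one_lt_s_sub_t (h : RootTriple a r s t) : 1 < s - t := by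
  have h1 := h.r_pos
  rw [h.s_eq, h.t_eq]
  have : -1 / (r + 1) - -(r + 1) / r = 1 + 1 / (r * (r + 1)) := by field_simp; ring
  rw [this]
  have : 0 < 1 / (r * (r + 1)) := by positivity
  linarith

lemma s_sub_t_mul_lt (h : RootTriple a r s t) : (s - t - 1) * a < 2 / 10 := by
  have h1 := h.r_pos
  have h2 := h.lt_r
  have h3 := h.eight_le
  rw [h.s_eq, h.t_eq]
  have : -1 / (r + 1) - -(r + 1) / r - 1 = 1 / (r * (r + 1)) := by field_simp; ring
  rw [this, div_mul_eq_mul_div, div_lt_div_iff₀ (by positivity) (by norm_num)]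
  nlinarith

lemma s_root (h : RootTriple a r s t) : s ^ 3 - a * s ^ 2 - (a + 3) * s - 1 = 0 := by
  have h1 := h.r_pos
  have h2 := h.root
  rw [h.s_eq]
  field_simp
  linear_combination -h2

lemma t_root (h : RootTriple a r s t) : t ^ 3 - a * t ^ 2 - (a + 3) * t - 1 = 0 := by
  have h1 := h.r_pos
  have h2 := h.root
  rw [h.t_eq]
  field_simp
  linear_combination h2

lemma s_eq_poly (h : RootTriple a r s t) : r ^ 2 - (a + 1) * r - 2 = s := by
  have h1 := h.r_pos
  have h2 := h.root
  rw [h.s_eq]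
  field_simp
  linear_combination h2

lemma t_eq_poly (h : RootTriple a r s t) : s ^ 2 - (a + 1) * s - 2 = t := by
  have h1 := h.r_pos
  have h2 := h.root
  rw [h.s_eq, h.t_eq]
  field_simp
  linear_combination -h2

lemma r_eq_poly (h : RootTriple a r s t) : t ^ 2 - (a + 1) * t - 2 = r := by
  have h1 := h.r_pos
  have h2 := h.root
  rw [h.t_eq]
  field_simp
  linear_combination -h2

lemma sum_mul_eq (h : RootTriple a r s t) : r * s + s * t + t * r = -(a + 3) := by
  have h1 := h.r_pos
  have h2 := h.root
  rw [h.s_eq, h.t_eq]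
  field_simp
  linear_combination -h2

end RootTriple

lemma rootTriple_simplestCubicRoot {a : ℤ} (ha : 8 ≤ a) :
    RootTriple a (simplestCubicRoot a) (-1 / (simplestCubicRoot a + 1))
      (-(simplestCubicRoot a + 1) / simplestCubicRoot a) := by
  have ha' : (8 : ℝ) ≤ a := by exact_mod_cast ha
  set A : ℝ := (a : ℝ) with hA
  set S : Set ℝ := {x : ℝ | x ^ 3 - A * x ^ 2 - (A + 3) * x - 1 = 0} with hS
  have hbig : ∀ x, A + 2 ≤ x → 0 < x ^ 3 - A * x ^ 2 - (A + 3) * x - 1 := by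
    intro x hx
    nlinarith [mul_nonneg (sub_nonneg.2 hx) (sub_nonneg.2 hx), mul_nonneg (sub_nonneg.2 hx)
      (mul_nonneg (by linarith : (0 : ℝ) ≤ x) (by linarith : (0 : ℝ) ≤ x))]
  obtain ⟨x₀, hx₀, hx₀S⟩ : ∃ x₀ ∈ Set.Ioo (A + 1) (A + 2), x₀ ∈ S := by
    have hc : ContinuousOn (fun x : ℝ => x ^ 3 - A * x ^ 2 - (A + 3) * x - 1)
        (Set.Icc (A + 1) (A + 2)) := by fun_prop
    have h0 := intermediate_value_Ioo (by linarith) hc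
    have : (0 : ℝ) ∈ Set.Ioo ((A + 1) ^ 3 - A * (A + 1) ^ 2 - (A + 3) * (A + 1) - 1)
        ((A + 2) ^ 3 - A * (A + 2) ^ 2 - (A + 3) * (A + 2) - 1) :=
      ⟨by nlinarith, hbig _ le_rfl⟩
    obtain ⟨y, hy, hy'⟩ := h0 this
    exact ⟨y, hy, hy'⟩
  have hbdd : BddAbove S := ⟨A + 2, fun x hx => by
    by_contra! hlt
    exact (hbig x hlt.le).ne' hx⟩
  have hcl : IsClosed S := isClosed_eq (by fun_prop) (by fun_prop)
  have hmem : sSup S ∈ S := hcl.csSup_mem ⟨x₀, hx₀S⟩ hbdd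
  have hr : simplestCubicRoot a = sSup S := rfl
  have hlo : A + 1 < sSup S := hx₀.1.trans_le (le_csSup hbdd hx₀S)
  rw [hr]
  refine ⟨ha', hlo, ?_, hmem, ?_, ?_⟩
  · by_contra! hle
    exact (hbig _ hle).ne' hmem
  · have : sSup S + 1 ≠ 0 := by linarith
    field_simp
  · have : sSup S ≠ 0 := by linarith
    field_simp

open Polynomial in
lemma irreducible_cubic {a : ℤ} (ha : 8 ≤ a) :
    Irreducible (X ^ 3 - C (a : ℚ) * X ^ 2 - C ((a : ℚ) + 3) * X - 1 : ℚ[X]) ∧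
    (X ^ 3 - C (a : ℚ) * X ^ 2 - C ((a : ℚ) + 3) * X - 1 : ℚ[X]).Monic ∧
    (X ^ 3 - C (a : ℚ) * X ^ 2 - C ((a : ℚ) + 3) * X - 1 : ℚ[X]).natDegree = 3 := by
  set f : ℚ[X] := X ^ 3 - C (a : ℚ) * X ^ 2 - C ((a : ℚ) + 3) * X - 1 with hf
  have hmonic : f.Monic := by rw [hf]; monicity!
  have hdeg : f.natDegree = 3 := by rw [hf]; compute_degree!
  refine ⟨?_, hmonic, hdeg⟩
  rw [hmonic.irreducible_iff_roots_eq_zero_of_degree_le_three (by omega) (by omega)]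
  rw [Multiset.eq_zero_iff_forall_notMem]
  intro q hq
  have hroot : q ^ 3 - a * q ^ 2 - (a + 3) * q - 1 = 0 := by
    have := (mem_roots'.1 hq).2
    simpa [hf, IsRoot] using this
  have h_integral : IsIntegral ℤ q := by
    refine ⟨X ^ 3 - C a * X ^ 2 - C (a + 3) * X - 1, by monicity!, ?_⟩
    simp only [eval₂_sub, eval₂_mul, eval₂_pow, eval₂_X, eval₂_C, eval₂_one]
    push_cast [eq_intCast]
    linarith
  obtain ⟨n, rfl⟩ := IsIntegrallyClosed.isIntegral_iff.1 h_integral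
  simp only [algebraMap_int_eq, eq_intCast] at hroot
  have hroot' : n * (n ^ 2 - a * n - (a + 3)) = 1 := by
    have : (n : ℚ) * (n ^ 2 - a * n - (a + 3)) = 1 := by linarith
    exact_mod_cast this
  rcases Int.isUnit_iff.1 (IsUnit.of_mul_eq_one _ hroot') with rfl | rfl
  · omega
  · omega

section NumberField

variable {a : ℤ} {K : Type*} [Field K] [NumberField K] {ρ : K} {r s t : ℝ}

lemma root_of_embedding (h : RootTriple a r s t) {σ : K →+* ℝ} (hσ : σ ρ = r) :
    ρ ^ 3 - a * ρ ^ 2 - (a + 3) * ρ - 1 = 0 := by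
  apply σ.injective
  simp only [map_sub, map_mul, map_pow, map_add, map_intCast, map_one, map_ofNat, map_zero, hσ]
  exact h.root

open Polynomial in
lemma exists_embeddings (ha : 8 ≤ a) (h : RootTriple a r s t)
    (hρ : ρ ^ 3 - a * ρ ^ 2 - (a + 3) * ρ - 1 = 0) (htop : IntermediateField.adjoin ℚ {ρ} = ⊤) :
    ∃ e₁ e₂ e₃ : K →+* ℝ, e₁ ρ = r ∧ e₂ ρ = s ∧ e₃ ρ = t ∧
      ∀ x : K, ((Algebra.norm ℚ x : ℚ) : ℝ) = e₁ x * e₂ x * e₃ x := by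
  obtain ⟨hirr, hmonic, hdeg⟩ := irreducible_cubic ha
  set f : ℚ[X] := X ^ 3 - C (a : ℚ) * X ^ 2 - C ((a : ℚ) + 3) * X - 1 with hf
  have hmin : minpoly ℚ ρ = f := by
    refine (minpoly.eq_of_irreducible_of_monic hirr ?_ hmonic).symm
    simpa [hf] using hρ
  have h_integral : IsIntegral ℚ ρ := Algebra.IsIntegral.isIntegral ρ
  have htop' : Algebra.adjoin ℚ {ρ} = ⊤ := by
    rw [← IntermediateField.adjoin_simple_toSubalgebra_of_isAlgebraic h_integral.isAlgebraic, htop]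
    rfl
  set pb := PowerBasis.ofAdjoinEqTop h_integral htop' with hpb
  have hgen : pb.gen = ρ := rfl
  have hrank : Module.finrank ℚ K = 3 := by
    rw [pb.finrank, hpb, PowerBasis.ofAdjoinEqTop_dim, hmin, hdeg]
  have key : ∀ y : ℝ, y ^ 3 - a * y ^ 2 - (a + 3) * y - 1 = 0 →
      ∃ e : K →ₐ[ℚ] ℝ, e ρ = y := fun y hy => by
    have : aeval y (minpoly ℚ pb.gen) = 0 := by
      rw [hgen, hmin]; simpa [hf] using hy
    exact ⟨pb.lift y this, pb.lift_gen y this⟩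
  obtain ⟨e₁, h₁⟩ := key r h.root
  obtain ⟨e₂, h₂⟩ := key s h.s_root
  obtain ⟨e₃, h₃⟩ := key t h.t_root
  refine ⟨e₁, e₂, e₃, h₁, h₂, h₃, fun x => ?_⟩
  classical
  let ι : ℝ →ₐ[ℚ] ℂ := (Complex.ofRealAm).restrictScalars ℚ
  have hι : ∀ y, ι y = (y : ℂ) := fun y => rfl
  have hrs : r ≠ s := by have := h.r_pos; have := h.s_neg; linarith
  have hrt : r ≠ t := by have := h.r_pos; have := h.t_lt; linarith
  have hst : s ≠ t := by have := h.one_lt_s_sub_t; linarith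
  have hne : ∀ {e e' : K →ₐ[ℚ] ℝ}, e ρ ≠ e' ρ → ι.comp e ≠ ι.comp e' := by
    intro e e' hee' heq
    apply hee'
    have := DFunLike.congr_fun heq ρ
    simpa [hι] using this
  have h12 : ι.comp e₁ ≠ ι.comp e₂ := hne (by rwa [h₁, h₂])
  have h13 : ι.comp e₁ ≠ ι.comp e₃ := hne (by rwa [h₁, h₃])
  have h23 : ι.comp e₂ ≠ ι.comp e₃ := hne (by rwa [h₂, h₃])
  have huniv : ({ι.comp e₁, ι.comp e₂, ι.comp e₃} : Finset (K →ₐ[ℚ] ℂ)) = Finset.univ := by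
    rw [← Finset.card_eq_iff_eq_univ, AlgHom.card, hrank]
    exact Finset.card_eq_three.2 ⟨_, _, _, h12, h13, h23, rfl⟩
  have hprod := Algebra.norm_eq_prod_embeddings ℚ ℂ x
  rw [← huniv, Finset.prod_insert (by simp [h12, h13]), Finset.prod_insert (by simp [h23]),
    Finset.prod_singleton] at hprod
  simp only [AlgHom.comp_apply, hι] at hprod
  have : ((Algebra.norm ℚ x : ℚ) : ℂ) = ((e₁ x * e₂ x * e₃ x : ℝ) : ℂ) := by
    push_cast
    rw [mul_assoc, ← hprod]
    simp
  exact_mod_cast this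

end NumberField

/-- The conjugate of the element with integer coordinates `n`, where `x` and `y` are the
corresponding conjugates of `ρ` and `ρ'`. -/
def emb (x y : ℝ) (n : ℤ × ℤ × ℤ) : ℝ := n.1 + n.2.1 * x + n.2.2 * y

/-- `Φ` is a system of integral coordinates on `𝓞 K` with respect to `1, ρ, ρ'`, where the three
real embeddings `e₁, e₂, e₃` of `𝓞 K` send `ρ` to `r`, `s`, `t`. -/
structure IsModel {K : Type*} [Field K] [NumberField K] (r s t : ℝ) (Φ : ℤ × ℤ × ℤ → 𝓞 K)
    (e₁ e₂ e₃ : 𝓞 K →+* ℝ) : Prop where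
  surjective : Function.Surjective Φ
  emb₁ : ∀ n, e₁ (Φ n) = emb r s n
  emb₂ : ∀ n, e₂ (Φ n) = emb s t n
  emb₃ : ∀ n, e₃ (Φ n) = emb t r n
  injective₁ : Function.Injective e₁
  injective₂ : Function.Injective e₂
  injective₃ : Function.Injective e₃
  absNorm_span : ∀ x, (Ideal.absNorm (Ideal.span {x}) : ℝ) = |e₁ x * e₂ x * e₃ x|
  exists_unit : ∃ η : (𝓞 K)ˣ, e₁ η = r ∧ e₂ η = s ∧ e₃ η = t
  exists_unit' : ∃ η : (𝓞 K)ˣ, e₁ η = r + 1 ∧ e₂ η = s + 1 ∧ e₃ η = t + 1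

lemma exists_isModel {a : ℤ} {K : Type*} [Field K] [NumberField K] {ρ : K} {r s t : ℝ}
    (ha : 8 ≤ a) (h : RootTriple a r s t) {σ : K →+* ℝ} (hσ : σ ρ = r)
    (htop : IntermediateField.adjoin ℚ {ρ} = ⊤)
    (hmono : Algebra.adjoin ℤ {ρ} = integralClosure ℤ K) :
    ∃ (Φ : ℤ × ℤ × ℤ → 𝓞 K) (e₁ e₂ e₃ : 𝓞 K →+* ℝ), IsModel r s t Φ e₁ e₂ e₃ := by
  have hρ := root_of_embedding h hσ
  obtain ⟨e₁, e₂, e₃, h₁, h₂, h₃, hnorm⟩ := exists_embeddings ha h hρ htop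
  have hmem : ρ ∈ integralClosure ℤ K := hmono ▸ Algebra.self_mem_adjoin_singleton ℤ ρ
  let θ : 𝓞 K := ⟨ρ, hmem⟩
  have hθ : algebraMap (𝓞 K) K θ = ρ := rfl
  let θ' : 𝓞 K := θ ^ 2 - (a + 1) * θ - 2
  have hθ' : algebraMap (𝓞 K) K θ' = ρ ^ 2 - (a + 1) * ρ - 2 := by
    simp [θ', hθ, map_ofNat (algebraMap (𝓞 K) K) 2]
  have hroot : θ ^ 3 - a * θ ^ 2 - (a + 3) * θ - 1 = 0 := by
    apply RingOfIntegers.coe_injective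
    simpa [hθ, map_ofNat (algebraMap (𝓞 K) K) 3] using hρ
  let Φ : ℤ × ℤ × ℤ → 𝓞 K := fun n => n.1 + n.2.1 * θ + n.2.2 * θ'
  have hΦ : ∀ n, algebraMap (𝓞 K) K (Φ n) =
      n.1 + n.2.1 * ρ + n.2.2 * (ρ ^ 2 - (a + 1) * ρ - 2) := fun n => by
    simp [Φ, hθ, hθ']
  have hinj : Function.Injective (algebraMap (𝓞 K) K) := RingOfIntegers.coe_injective
  refine ⟨Φ, e₁.comp (algebraMap _ _), e₂.comp (algebraMap _ _), e₃.comp (algebraMap _ _),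
    ⟨?_, ?_, ?_, ?_, ?_, ?_, ?_, ?_, ?_, ?_⟩⟩
  · rintro ⟨x, hx⟩
    have hx' : x ∈ Algebra.adjoin ℤ {ρ} := hmono ▸ hx
    suffices ∃ u v w : ℤ, x = u + v * ρ + w * ρ ^ 2 by
      obtain ⟨u, v, w, huvw⟩ := this
      refine ⟨(u + 2 * w, v + (a + 1) * w, w), hinj ?_⟩
      rw [hΦ]
      change _ = x
      rw [huvw]
      push_cast
      ring
    induction hx' using Algebra.adjoin_induction with
    | mem y hy => exact ⟨0, 1, 0, by simpa using hy⟩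
    | algebraMap n => exact ⟨n, 0, 0, by simp⟩
    | add y z hy hz ihy ihz =>
      obtain ⟨u, v, w, rfl⟩ := ihy (hmono ▸ hy)
      obtain ⟨u', v', w', rfl⟩ := ihz (hmono ▸ hz)
      exact ⟨u + u', v + v', w + w', by push_cast; ring⟩
    | mul y z hy hz ihy ihz =>
      obtain ⟨u, v, w, rfl⟩ := ihy (hmono ▸ hy)
      obtain ⟨u', v', w', rfl⟩ := ihz (hmono ▸ hz)
      refine ⟨u * u' + (v * w' + w * v') + w * w' * a,
        u * v' + v * u' + (v * w' + w * v') * (a + 3) + w * w' * (a * (a + 3) + 1),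
        u * w' + v * v' + w * u' + (v * w' + w * v') * a + w * w' * (a ^ 2 + a + 3), ?_⟩
      push_cast
      linear_combination ((v * w' + w * v' : K) + w * w' * (ρ + a)) * hρ
  · intro n
    simp only [RingHom.comp_apply, hΦ, emb, map_add, map_mul, map_sub, map_pow, map_intCast,
      map_one, map_ofNat, h₁, h.s_eq_poly]
  · intro n
    simp only [RingHom.comp_apply, hΦ, emb, map_add, map_mul, map_sub, map_pow, map_intCast,
      map_one, map_ofNat, h₂, h.t_eq_poly]
  · intro n
    simp only [RingHom.comp_apply, hΦ, emb, map_add, map_mul, map_sub, map_pow, map_intCast,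
      map_one, map_ofNat, h₃, h.r_eq_poly]
  · exact e₁.injective.comp hinj
  · exact e₂.injective.comp hinj
  · exact e₃.injective.comp hinj
  · intro x
    rw [Ideal.absNorm_span_singleton]
    simp only [RingHom.comp_apply]
    rw [← hnorm, ← Algebra.coe_norm_int]
    simp
  · refine ⟨Units.mkOfMulEqOne θ (θ ^ 2 - a * θ - (a + 3)) (by linear_combination hroot),
      ?_, ?_, ?_⟩ <;> simp [hθ, h₁, h₂, h₃]
  · refine ⟨Units.mkOfMulEqOne (θ + 1) (-θ') (by simp only [θ']; linear_combination -hroot),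
      ?_, ?_, ?_⟩ <;> simp [hθ, h₁, h₂, h₃]

section Geometry

variable {a r s t : ℝ}

lemma emb_one_sub_emb_two (n : ℤ × ℤ × ℤ) :
    emb r s n - emb s t n = n.2.1 * (r - s) + n.2.2 * (s - t) := by
  simp only [emb]; ring

lemma emb_three_sub_emb_two (n : ℤ × ℤ × ℤ) :
    emb t r n - emb s t n = n.2.2 * (r - t) - n.2.1 * (s - t) := by
  simp only [emb]; ring

lemma emb_sub (x y : ℝ) (m n : ℤ × ℤ × ℤ) : emb x y (m - n) = emb x y m - emb x y n := by
  simp only [emb, Prod.fst_sub, Prod.snd_sub]; push_cast; ring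

lemma RootTriple.abs_mul_le_and (h : RootTriple a r s t) (n : ℤ × ℤ × ℤ) :
    |(n.2.1 : ℝ)| * a ≤ |emb r s n - emb s t n| + |emb t r n - emb s t n| ∧
    |(n.2.2 : ℝ)| * a ≤ |emb r s n - emb s t n| + |emb t r n - emb s t n| := by
  set p := emb r s n - emb s t n with hp
  set q := emb t r n - emb s t n with hq
  rw [emb_one_sub_emb_two] at hp
  rw [emb_three_sub_emb_two] at hq
  set v : ℝ := (n.2.1 : ℝ)
  set w : ℝ := (n.2.2 : ℝ)
  have ha := h.eight_le
  have hA : a + 1 < r - s := by have := h.lt_r; have := h.s_neg; linarith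
  have hB : a + 2 < r - t := by have := h.lt_r; have := h.t_lt; linarith
  have hd := h.one_lt_s_sub_t
  have hd' : s - t < 10 / 9 := by have := h.lt_t; have := h.s_neg; linarith
  set A := r - s
  set B := r - t
  set d := s - t
  have hv : v * (A * B + d ^ 2) = B * p - d * q := by rw [hp, hq]; ring
  have hw : w * (A * B + d ^ 2) = A * q + d * p := by rw [hp, hq]; ring
  have hΔ : 0 < A * B + d ^ 2 := by have : 0 < A * B := by nlinarith
                                    positivity
  have hp0 := abs_nonneg p
  have hq0 := abs_nonneg q
  have hv' : |v| * (A * B + d ^ 2) ≤ B * (|p| + |q|) := by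
    rw [← abs_of_pos hΔ, ← abs_mul, hv]
    calc |B * p - d * q| ≤ |B * p| + |d * q| := abs_sub _ _
      _ = B * |p| + d * |q| := by rw [abs_mul, abs_mul, abs_of_pos (show 0 < B by linarith),
          abs_of_pos (show 0 < d by linarith)]
      _ ≤ _ := by nlinarith
  have hw' : |w| * (A * B + d ^ 2) ≤ A * (|p| + |q|) := by
    rw [← abs_of_pos hΔ, ← abs_mul, hw]
    calc |A * q + d * p| ≤ |A * q| + |d * p| := abs_add_le _ _
      _ = A * |q| + d * |p| := by rw [abs_mul, abs_mul, abs_of_pos (show 0 < A by linarith),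
          abs_of_pos (show 0 < d by linarith)]
      _ ≤ _ := by nlinarith
  have hv0 := abs_nonneg v
  have hw0 := abs_nonneg w
  constructor
  · have : |v| * a * B ≤ (|p| + |q|) * B := by
      have : |v| * (a * B) ≤ |v| * (A * B + d ^ 2) := by gcongr; nlinarith
      linarith
    exact le_of_mul_le_mul_right this (by linarith)
  · have : |w| * a * A ≤ (|p| + |q|) * A := by
      have : |w| * (a * A) ≤ |w| * (A * B + d ^ 2) := by gcongr; nlinarith
      linarith
    exact le_of_mul_le_mul_right this (by linarith)

lemma RootTriple.eq_zero_of_abs_lt (h : RootTriple a r s t) {n : ℤ × ℤ × ℤ}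
    (hp : |emb r s n - emb s t n| < a) (hq : |emb t r n - emb s t n| < a)
    (hz : |emb s t n| < 1) : n = 0 := by
  obtain ⟨u, v, w⟩ := n
  rw [emb_one_sub_emb_two] at hp
  rw [emb_three_sub_emb_two] at hq
  simp only at hp hq
  have ha := h.eight_le
  have hA : a + 1 < r - s := by have := h.lt_r; have := h.s_neg; linarith
  have hB : a + 2 < r - t := by have := h.lt_r; have := h.t_lt; linarith
  have hd := h.one_lt_s_sub_t
  have hd' := h.s_sub_t_mul_lt
  set A := r - s
  set B := r - t
  set d := s - t
  have hΔ : 0 < A * B + d ^ 2 := by have : 0 < A * B := by nlinarith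
                                    positivity
  rw [abs_lt] at hp hq
  have hv1 : (v : ℝ) < 1 := by nlinarith
  have hv2 : -1 < (v : ℝ) := by nlinarith
  have hw1 : (w : ℝ) < 1 := by nlinarith
  have hw2 : -1 < (w : ℝ) := by nlinarith
  obtain rfl : v = 0 := by
    have h1 : v < 1 := by exact_mod_cast hv1
    have h2 : -1 < v := by exact_mod_cast hv2
    omega
  obtain rfl : w = 0 := by
    have h1 : w < 1 := by exact_mod_cast hw1
    have h2 : -1 < w := by exact_mod_cast hw2
    omega
  simp only [emb, Int.cast_zero, zero_mul, add_zero] at hz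
  obtain rfl : u = 0 := by
    have : |u| < 1 := by exact_mod_cast hz
    exact Int.abs_lt_one_iff.1 this
  rfl

/-- The three numbers are within a factor `2a` of each other in absolute value. -/
def Balanced (a y₁ y₂ y₃ : ℝ) : Prop :=
  |y₁| ≤ 2 * a * |y₂| ∧ |y₁| ≤ 2 * a * |y₃| ∧ |y₂| ≤ 2 * a * |y₁| ∧
  |y₂| ≤ 2 * a * |y₃| ∧ |y₃| ≤ 2 * a * |y₁| ∧ |y₃| ≤ 2 * a * |y₂|

lemma RootTriple.le_of_sq_le (h : RootTriple a r s t) {α β γ η₁ η₂ η₃ : ℝ}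
    (h₁ : |η₁| ≤ 1 / r) (h₂ : |η₂| ≤ (r + 1) / r) (h₃ : |η₃| ≤ r + 1) (hβ : |β| ≤ |α|)
    (hG : α ^ 2 + β ^ 2 + γ ^ 2 ≤ (η₁ * α) ^ 2 + (η₂ * β) ^ 2 + (η₃ * γ) ^ 2) :
    |α| ≤ 2 * a * |γ| := by
  have ha := h.eight_le
  have hr := h.r_pos
  have hr1 := h.lt_r
  have hr2 := h.r_lt
  have h₁' : |η₁| ≤ 1 / 9 := h₁.trans (by gcongr; linarith)
  have h₂' : |η₂| ≤ 10 / 9 := h₂.trans (by rw [div_le_div_iff₀ hr (by norm_num)]; linarith)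
  have k₁ : η₁ ^ 2 ≤ 1 / 81 := by
    rw [← sq_abs]; nlinarith [abs_nonneg η₁]
  have k₂ : η₂ ^ 2 ≤ 100 / 81 := by
    rw [← sq_abs]; nlinarith [abs_nonneg η₂]
  have k₃ : η₃ ^ 2 ≤ (a + 3) ^ 2 := by
    rw [← sq_abs]; nlinarith [abs_nonneg η₃]
  have hβ' : β ^ 2 ≤ α ^ 2 := sq_le_sq.2 hβ
  have e₁ : (η₁ * α) ^ 2 ≤ 1 / 81 * α ^ 2 := by rw [mul_pow]; gcongr
  have e₂ : (η₂ * β) ^ 2 ≤ 100 / 81 * β ^ 2 := by rw [mul_pow]; gcongr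
  have e₃ : (η₃ * γ) ^ 2 ≤ (a + 3) ^ 2 * γ ^ 2 := by rw [mul_pow]; gcongr
  have key : α ^ 2 ≤ (2 * a * γ) ^ 2 := by
    have e₄ : 61 / 81 * α ^ 2 ≤ (a + 3) ^ 2 * γ ^ 2 := by nlinarith [sq_nonneg γ]
    have e₅ : (a + 3) ^ 2 * γ ^ 2 ≤ 61 / 81 * (2 * a) ^ 2 * γ ^ 2 := by
      gcongr
      nlinarith
    nlinarith
  have := sq_le_sq.1 key
  rwa [abs_mul, abs_of_pos (by positivity : 0 < 2 * a)] at this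

end Geometry

section Reduction

variable {a : ℤ} {K : Type*} [Field K] [NumberField K] {r s t : ℝ} {Φ : ℤ × ℤ × ℤ → 𝓞 K}
  {e₁ e₂ e₃ : 𝓞 K →+* ℝ}

lemma IsModel.exists_nat_eq_sum_sq (hM : IsModel r s t Φ e₁ e₂ e₃) (h : RootTriple a r s t)
    (x : 𝓞 K) : ∃ N : ℕ, (N : ℝ) = e₁ x ^ 2 + e₂ x ^ 2 + e₃ x ^ 2 := by
  obtain ⟨⟨u, v, w⟩, rfl⟩ := hM.surjective x
  rw [hM.emb₁, hM.emb₂, hM.emb₃]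
  have key : emb r s (u, v, w) ^ 2 + emb s t (u, v, w) ^ 2 + emb t r (u, v, w) ^ 2 =
      ((3 * u ^ 2 + (v ^ 2 + w ^ 2) * (a ^ 2 + 2 * (a + 3)) + 2 * a * u * (v + w)
        - 2 * v * w * (a + 3) : ℤ) : ℝ) := by
    have h1 := h.sum_eq
    have h2 := h.sum_mul_eq
    simp only [emb]
    push_cast
    have h3 : r ^ 2 + s ^ 2 + t ^ 2 = a ^ 2 + 2 * (a + 3) := by
      linear_combination (r + s + t + a) * h1 - 2 * h2
    linear_combination (v ^ 2 + w ^ 2 : ℝ) * h3 + (2 * u * (v + w) : ℝ) * h1 + (2 * v * w : ℝ) * h2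
  rw [key]
  have hnn : (0 : ℤ) ≤ 3 * u ^ 2 + (v ^ 2 + w ^ 2) * (a ^ 2 + 2 * (a + 3)) + 2 * a * u * (v + w)
        - 2 * v * w * (a + 3) := by
    have : (0 : ℝ) ≤ _ := key ▸ (by positivity :
      0 ≤ emb r s (u, v, w) ^ 2 + emb s t (u, v, w) ^ 2 + emb t r (u, v, w) ^ 2)
    exact_mod_cast this
  obtain ⟨N, hN⟩ := Int.eq_ofNat_of_zero_le hnn
  exact ⟨N, by rw [hN]; simp⟩

lemma IsModel.balanced (hM : IsModel r s t Φ e₁ e₂ e₃) (h : RootTriple a r s t) {x : 𝓞 K}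
    (hmin : ∀ η : (𝓞 K)ˣ, e₁ x ^ 2 + e₂ x ^ 2 + e₃ x ^ 2 ≤
      (e₁ η * e₁ x) ^ 2 + (e₂ η * e₂ x) ^ 2 + (e₃ η * e₃ x) ^ 2) :
    Balanced a (e₁ x) (e₂ x) (e₃ x) := by
  obtain ⟨η, h₁, h₂, h₃⟩ := hM.exists_unit
  obtain ⟨η', h₁', h₂', h₃'⟩ := hM.exists_unit'
  have hr := h.r_pos
  have hr1 : 1 ≤ r := by have := h.lt_r; have := h.eight_le; linarith
  have a₁ : |r| = r := abs_of_pos hr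
  have a₂ : |s| = 1 / (r + 1) := by
    rw [abs_of_neg h.s_neg, h.s_eq]; ring
  have a₃ : |t| = (r + 1) / r := by
    rw [abs_of_neg (by linarith [h.t_lt]), h.t_eq]; ring
  have b₁ : |r + 1| = r + 1 := abs_of_pos (by linarith)
  have b₂ : |s + 1| = r / (r + 1) := by
    rw [abs_of_pos (by linarith [h.neg_s_lt]), h.s_eq]; field_simp; ring
  have b₃ : |t + 1| = 1 / r := by
    rw [abs_of_neg (by linarith [h.t_lt]), h.t_eq]; field_simp; ring
  have i₁ : 1 / (r + 1) ≤ 1 / r := by gcongr; linarith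
  have i₂ : r / (r + 1) ≤ (r + 1) / r := by
    rw [div_le_div_iff₀ (by linarith) hr]; nlinarith
  have H12 : |e₃ x| ≤ |e₁ x| → |e₁ x| ≤ 2 * a * |e₂ x| := fun hle => by
    refine h.le_of_sq_le (η₁ := e₁ ↑η⁻¹) (η₂ := e₃ ↑η⁻¹) (η₃ := e₂ ↑η⁻¹) (β := e₃ x) ?_ ?_ ?_ hle
      (by linarith [hmin η⁻¹])
    all_goals simp only [map_units_inv, h₁, h₂, h₃, abs_inv, a₁, a₂, a₃]
    · simp
    · simpa using i₂
    · simp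
  have H21 : |e₃ x| ≤ |e₂ x| → |e₂ x| ≤ 2 * a * |e₁ x| := fun hle => by
    refine h.le_of_sq_le (η₁ := e₂ η) (η₂ := e₃ η) (η₃ := e₁ η) (β := e₃ x) ?_ ?_ ?_ hle
      (by linarith [hmin η])
    all_goals simp only [h₁, h₂, h₃, a₁, a₂, a₃]
    · exact i₁
    · exact le_rfl
    · linarith
  have H13 : |e₂ x| ≤ |e₁ x| → |e₁ x| ≤ 2 * a * |e₃ x| := fun hle => by
    refine h.le_of_sq_le (η₁ := e₁ ↑η'⁻¹) (η₂ := e₂ ↑η'⁻¹) (η₃ := e₃ ↑η'⁻¹) (β := e₂ x) ?_ ?_ ?_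
      hle (by linarith [hmin η'⁻¹])
    all_goals simp only [map_units_inv, h₁', h₂', h₃', abs_inv, b₁, b₂, b₃]
    · simpa using i₁
    · simp
    · simp
  have H31 : |e₂ x| ≤ |e₃ x| → |e₃ x| ≤ 2 * a * |e₁ x| := fun hle => by
    refine h.le_of_sq_le (η₁ := e₃ η') (η₂ := e₂ η') (η₃ := e₁ η') (β := e₂ x) ?_ ?_ ?_ hle
      (by linarith [hmin η'])
    all_goals simp only [h₁', h₂', h₃', b₁, b₂, b₃]
    · exact le_rfl
    · exact i₂
    · exact le_rfl
  have j₁ : (r + 1) * r⁻¹ = (r + 1) / r := by field_simp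
  have H32 : |e₁ x| ≤ |e₃ x| → |e₃ x| ≤ 2 * a * |e₂ x| := fun hle => by
    refine h.le_of_sq_le (η₁ := e₃ ↑(η' * η⁻¹)) (η₂ := e₁ ↑(η' * η⁻¹)) (η₃ := e₂ ↑(η' * η⁻¹))
      (β := e₁ x) ?_ ?_ ?_ hle (by linarith [hmin (η' * η⁻¹)])
    all_goals simp only [Units.val_mul, map_mul, map_units_inv, h₁, h₂, h₃, h₁', h₂', h₃',
      abs_mul, abs_inv, a₁, a₂, a₃, b₁, b₂, b₃]
    · refine le_trans (le_of_eq ?_) i₁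
      field_simp
    · exact j₁.le
    · refine le_of_eq_of_le (b := r) ?_ (by linarith)
      field_simp
  have H23 : |e₁ x| ≤ |e₂ x| → |e₂ x| ≤ 2 * a * |e₃ x| := fun hle => by
    refine h.le_of_sq_le (η₁ := e₂ ↑(η * η'⁻¹)) (η₂ := e₁ ↑(η * η'⁻¹)) (η₃ := e₃ ↑(η * η'⁻¹))
      (β := e₁ x) ?_ ?_ ?_ hle (by linarith [hmin (η * η'⁻¹)])
    all_goals simp only [Units.val_mul, map_mul, map_units_inv, h₁, h₂, h₃, h₁', h₂', h₃',
      abs_mul, abs_inv, a₁, a₂, a₃, b₁, b₂, b₃]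
    · refine le_of_eq ?_
      field_simp
    · exact i₂
    · refine le_of_eq ?_
      field_simp
  refine ⟨?_, ?_, ?_, ?_, ?_, ?_⟩
  · rcases le_total |e₃ x| |e₁ x| with hle | hle
    exacts [H12 hle, hle.trans (H32 hle)]
  · rcases le_total |e₂ x| |e₁ x| with hle | hle
    exacts [H13 hle, hle.trans (H23 hle)]
  · rcases le_total |e₃ x| |e₂ x| with hle | hle
    exacts [H21 hle, hle.trans (H31 hle)]
  · rcases le_total |e₁ x| |e₂ x| with hle | hle
    exacts [H23 hle, hle.trans (H13 hle)]
  · rcases le_total |e₂ x| |e₃ x| with hle | hle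
    exacts [H31 hle, hle.trans (H21 hle)]
  · rcases le_total |e₁ x| |e₃ x| with hle | hle
    exacts [H32 hle, hle.trans (H12 hle)]

lemma IsModel.exists_balanced (hM : IsModel r s t Φ e₁ e₂ e₃) (h : RootTriple a r s t)
    {I : Ideal (𝓞 K)} (hI : I.IsPrincipal) :
    ∃ n, Ideal.span {Φ n} = I ∧ Balanced a (emb r s n) (emb s t n) (emb t r n) := by
  choose m hm using hM.exists_nat_eq_sum_sq h
  obtain ⟨g₀, hg₀⟩ := hI
  obtain ⟨g, hg, hgmin⟩ := (measure m).wf.has_min {g | Ideal.span {g} = I} ⟨g₀, hg₀.symm⟩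
  obtain ⟨n, rfl⟩ := hM.surjective g
  refine ⟨n, hg, ?_⟩
  rw [← hM.emb₁, ← hM.emb₂, ← hM.emb₃]
  refine hM.balanced h fun η => ?_
  have hη : Ideal.span {η * Φ n} = I := by
    rw [← hg, Ideal.span_singleton_eq_span_singleton]
    exact associated_unit_mul_left _ _ η.isUnit
  have hle : m (Φ n) ≤ m (η * Φ n) := not_lt.1 (hgmin _ hη)
  have : (m (Φ n) : ℝ) ≤ m (η * Φ n) := by exact_mod_cast hle
  rw [hm, hm] at this
  simpa only [map_mul] using this

end Reduction

section Counting

open Finset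

lemma sum_Ioc_inv_le_log_sub_log {m n : ℕ} (hm : 1 ≤ m) (hmn : m ≤ n) :
    ∑ i ∈ Ioc m n, (1 / i : ℝ) ≤ Real.log n - Real.log m := by
  induction n, hmn using Nat.le_induction with
  | base => simp
  | succ n hn ih =>
    rw [← Finset.insert_Ioc_right_eq_Ioc_add_one hn, sum_insert (by simp)]
    have hn0 : (0 : ℝ) < n := by exact_mod_cast hm.trans hn
    have h1 : (0 : ℝ) < ((n + 1 : ℕ) : ℝ) / n := by positivity
    have h2 := Real.one_sub_inv_le_log_of_pos h1
    rw [Real.log_div (by positivity) hn0.ne'] at h2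
    have h3 : 1 - (((n + 1 : ℕ) : ℝ) / n)⁻¹ = 1 / ((n + 1 : ℕ) : ℝ) := by
      push_cast; field_simp; ring
    rw [h3] at h2
    linarith

lemma sum_Ioc_floor_inv_le {A : ℝ} {n : ℕ} (hA : 0 < A) (hAn : A ≤ n) :
    ∑ i ∈ Ioc ⌊A⌋₊ n, (1 / i : ℝ) ≤ 2 + Real.log (n / A) := by
  have hn : (0 : ℝ) < n := hA.trans_le hAn
  rw [Real.log_div hn.ne' hA.ne']
  rcases Nat.eq_zero_or_pos ⌊A⌋₊ with h0 | hpos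
  · have hA1 : A < 1 := Nat.floor_eq_zero.1 h0
    have hn1 : 1 ≤ n := by exact_mod_cast hn
    have hunion : Ioc 0 n = insert 1 (Ioc 1 n) := by
      ext i; simp only [mem_Ioc, mem_insert]; omega
    rw [h0, hunion, sum_insert (by simp)]
    have := sum_Ioc_inv_le_log_sub_log le_rfl hn1
    have := Real.log_neg hA hA1
    simp only [Nat.cast_one, Real.log_one] at *
    linarith
  · have hle : ⌊A⌋₊ ≤ n := Nat.floor_le_of_le hAn
    have h1 := sum_Ioc_inv_le_log_sub_log hpos hle
    have hpos' : (1 : ℝ) ≤ ⌊A⌋₊ := by exact_mod_cast hpos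
    have h2 : A ≤ 2 * ⌊A⌋₊ := by linarith [Nat.lt_floor_add_one A]
    have h3 := Real.log_le_log hA h2
    rw [Real.log_mul (by norm_num) (by positivity)] at h3
    have h4 : Real.log 2 ≤ 1 := by linarith [Real.log_two_lt_d9]
    linarith

lemma sum_Icc_min_le {f g : ℕ → ℝ} (hf : ∀ i, 0 ≤ f i) (hg : ∀ i, 0 ≤ g i) (M N : ℕ) :
    ∑ i ∈ Icc 1 N, min (f i) (g i) ≤ ∑ i ∈ Icc 1 M, f i + ∑ i ∈ Ioc M N, g i := by
  have hsub : Icc 1 N ⊆ Icc 1 M ∪ Ioc M N := fun i => by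
    simp only [mem_Icc, mem_union, mem_Ioc]; omega
  have hdisj : Disjoint (Icc 1 M) (Ioc M N) := disjoint_left.2 fun i => by
    simp only [mem_Icc, mem_Ioc]; omega
  calc _ ≤ ∑ i ∈ Icc 1 M ∪ Ioc M N, min (f i) (g i) :=
        sum_le_sum_of_subset_of_nonneg hsub fun i _ _ => le_min (hf i) (hg i)
    _ = _ := sum_union hdisj
    _ ≤ _ := add_le_add (sum_le_sum fun i _ => min_le_left _ _)
        (sum_le_sum fun i _ => min_le_right _ _)

lemma card_hyperbola_le {E : ℕ} {F : ℝ} (hF : 0 < F) (hFE : F ≤ (E : ℝ) ^ 2) :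
    (#{p ∈ Icc 1 E ×ˢ Icc 1 E | (p.1 * p.2 : ℝ) ≤ F} : ℝ) ≤
      F * (3 + Real.log ((E : ℝ) ^ 2 / F)) := by
  have hE : (0 : ℝ) < E := by
    rcases Nat.eq_zero_or_pos E with rfl | h
    · norm_num at hFE; linarith
    · exact_mod_cast h
  have hsub : {p ∈ Icc 1 E ×ˢ Icc 1 E | (p.1 * p.2 : ℝ) ≤ F} ⊆
      (Icc 1 E).biUnion fun i => (Icc 1 (min E ⌊F / i⌋₊)).image fun j => (i, j) := by
    rintro ⟨i, j⟩ hp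
    simp only [mem_filter, mem_product, mem_Icc] at hp
    obtain ⟨⟨hi, hj⟩, hij⟩ := hp
    simp only [mem_biUnion, mem_image, mem_Icc, Prod.mk.injEq]
    refine ⟨i, hi, j, ⟨hj.1, le_min hj.2 (Nat.le_floor ?_)⟩, rfl, rfl⟩
    have : (0 : ℝ) < i := by exact_mod_cast hi.1
    rw [le_div_iff₀ this]
    linarith
  have h1 : (#{p ∈ Icc 1 E ×ˢ Icc 1 E | (p.1 * p.2 : ℝ) ≤ F} : ℝ) ≤
      ∑ i ∈ Icc 1 E, min (E : ℝ) (F / i) := by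
    have hcard := (card_le_card hsub).trans card_biUnion_le
    refine (Nat.cast_le.2 hcard).trans ?_
    push_cast
    refine sum_le_sum fun i _ => ?_
    refine (Nat.cast_le.2 card_image_le).trans ?_
    rw [Nat.card_Icc, Nat.add_sub_cancel, Nat.cast_min]
    exact min_le_min le_rfl (Nat.floor_le (by positivity))
  have h2 := sum_Icc_min_le (f := fun _ => (E : ℝ)) (g := fun i => F / i) (fun _ => hE.le)
    (fun i => by positivity) ⌊F / E⌋₊ E
  have h3 : ∑ i ∈ Icc 1 ⌊F / E⌋₊, (E : ℝ) ≤ F := by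
    rw [sum_const, Nat.card_Icc, Nat.add_sub_cancel, nsmul_eq_mul, ← le_div_iff₀ hE]
    exact Nat.floor_le (by positivity)
  have h4 : ∑ i ∈ Ioc ⌊F / E⌋₊ E, F / i ≤ F * (2 + Real.log ((E : ℝ) ^ 2 / F)) := by
    have := sum_Ioc_floor_inv_le (A := F / E) (n := E) (by positivity)
      (by rw [div_le_iff₀ hE]; nlinarith)
    have heq : (E : ℝ) / (F / E) = (E : ℝ) ^ 2 / F := by field_simp
    rw [heq] at this
    calc _ = F * ∑ i ∈ Ioc ⌊F / E⌋₊ E, (1 / i : ℝ) := by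
          rw [mul_sum]; exact sum_congr rfl fun i _ => by ring
      _ ≤ _ := by gcongr
  linarith

/-- The number of `(i, k)` with `i ≤ 8k` and `i k² ≤ 2Y³` is `O(Y²)`. -/
lemma card_sq_region_le {Y : ℝ} (hY : 0 < Y) (N : ℕ) :
    (∑ k ∈ Icc 1 N, min (8 * (k : ℝ)) (2 * Y ^ 3 / (k : ℝ) ^ 2)) ≤ 12 * Y ^ 2 := by
  have h := sum_Icc_min_le (f := fun k => 8 * (k : ℝ)) (g := fun k => 2 * Y ^ 3 / (k : ℝ) ^ 2)
    (fun _ => by positivity) (fun _ => by positivity) ⌊Y⌋₊ N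
  have hM : (⌊Y⌋₊ : ℝ) ≤ Y := Nat.floor_le hY.le
  have h1 : ∑ k ∈ Icc 1 ⌊Y⌋₊, 8 * (k : ℝ) ≤ 8 * Y ^ 2 := by
    calc _ ≤ ∑ k ∈ Icc 1 ⌊Y⌋₊, 8 * Y := sum_le_sum fun k hk => by
          have : (k : ℝ) ≤ ⌊Y⌋₊ := by exact_mod_cast (mem_Icc.1 hk).2
          linarith
      _ = ⌊Y⌋₊ * (8 * Y) := by rw [sum_const, Nat.card_Icc, Nat.add_sub_cancel, nsmul_eq_mul]
      _ ≤ Y * (8 * Y) := by gcongr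
      _ = _ := by ring
  have h2 : ∑ k ∈ Ioc ⌊Y⌋₊ N, 2 * Y ^ 3 / (k : ℝ) ^ 2 ≤ 4 * Y ^ 2 := by
    have hs := sum_Ioo_inv_sq_le (α := ℝ) ⌊Y⌋₊ (N + 1)
    have heq : Ioo ⌊Y⌋₊ (N + 1) = Ioc ⌊Y⌋₊ N := by
      ext i; simp only [mem_Ioo, mem_Ioc]; omega
    rw [heq] at hs
    calc _ = 2 * Y ^ 3 * ∑ k ∈ Ioc ⌊Y⌋₊ N, ((k : ℝ) ^ 2)⁻¹ := by
          rw [mul_sum]; exact sum_congr rfl fun i _ => by ring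
      _ ≤ 2 * Y ^ 3 * (2 / (⌊Y⌋₊ + 1)) := by gcongr
      _ ≤ 2 * Y ^ 3 * (2 / Y) := by gcongr; exact (Nat.lt_floor_add_one Y).le
      _ = _ := by field_simp; ring
  linarith

lemma sum_card_hyperbola_le {a y : ℝ} (ha : 8 ≤ a) (hy : 1 ≤ y) :
    (∑ k ∈ Icc 1 ⌊y⌋₊, (#{p ∈ Icc 1 (8 * k) ×ˢ Icc 1 (8 * k) |
      (p.1 * p.2 : ℝ) ≤ 4 * y ^ 3 / (a ^ 2 * k)} : ℝ)) ≤
      160 * (Real.log a ^ 2 * y ^ 3 / a ^ 2) := by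
  set L := Real.log a with hL
  have hL2 : 2 ≤ L := by
    have h8 : Real.log 8 = 3 * Real.log 2 := by
      rw [show (8 : ℝ) = 2 ^ 3 by norm_num, Real.log_pow]; norm_num
    have := Real.log_le_log (by norm_num) ha
    linarith [Real.log_two_gt_d9]
  have ha0 : 0 < a := by linarith
  have hlog16 : Real.log (16 * a ^ 2) ≤ 4 * L := by
    calc _ ≤ Real.log (a ^ 4) := Real.log_le_log (by positivity) (by
          have : (16 : ℝ) ≤ a ^ 2 := by nlinarith
          nlinarith)
      _ = 4 * L := by rw [Real.log_pow]; norm_num [hL]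
  obtain ⟨κ, hκ, hκ3⟩ : ∃ κ : ℝ, 0 < κ ∧ κ ^ 3 = y ^ 3 / (16 * a ^ 2) := by
    refine ⟨(y ^ 3 / (16 * a ^ 2)) ^ ((1 : ℝ) / 3), by positivity, ?_⟩
    rw [← Real.rpow_natCast, ← Real.rpow_mul (by positivity)]
    norm_num
  have hκy : κ ≤ y := by
    refine le_of_pow_le_pow_left₀ (n := 3) (by norm_num) (by linarith) ?_
    rw [hκ3]
    exact div_le_self (by positivity) (by nlinarith)
  set G : ℕ → ℝ := fun k => (4 * y ^ 3 / (a ^ 2 * k)) * (6 * L) with hG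
  have hterm : ∀ k ∈ Icc 1 ⌊y⌋₊, (#{p ∈ Icc 1 (8 * k) ×ˢ Icc 1 (8 * k) |
      (p.1 * p.2 : ℝ) ≤ 4 * y ^ 3 / (a ^ 2 * k)} : ℝ) ≤
      if (k : ℝ) ≤ κ then 64 * κ ^ 2 else G k := by
    intro k hk
    obtain ⟨hk1, hk2⟩ := mem_Icc.1 hk
    have hk0 : (0 : ℝ) < k := by exact_mod_cast hk1
    have hky : (k : ℝ) ≤ y := (Nat.le_floor_iff (by linarith)).1 hk2
    split_ifs with hkκ
    · have : #{p ∈ Icc 1 (8 * k) ×ˢ Icc 1 (8 * k) |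
          (p.1 * p.2 : ℝ) ≤ 4 * y ^ 3 / (a ^ 2 * k)} ≤ (8 * k) * (8 * k) := by
        refine (card_filter_le _ _).trans ?_
        rw [card_product, Nat.card_Icc, Nat.add_sub_cancel]
      calc _ ≤ (((8 * k) * (8 * k) : ℕ) : ℝ) := by exact_mod_cast this
        _ = 64 * (k : ℝ) ^ 2 := by push_cast; ring
        _ ≤ _ := by gcongr
    · push Not at hkκ
      have hk3 : κ ^ 3 ≤ (k : ℝ) ^ 3 := by gcongr
      rw [hκ3, div_le_iff₀ (by positivity)] at hk3
      have hk3' : (k : ℝ) ^ 3 ≤ y ^ 3 := by gcongr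
      refine (card_hyperbola_le (by positivity) ?_).trans ?_
      · rw [div_le_iff₀ (by positivity)]
        push_cast
        nlinarith
      · simp only [hG]
        gcongr
        have : Real.log (((8 * k : ℕ) : ℝ) ^ 2 / (4 * y ^ 3 / (a ^ 2 * k))) ≤
            Real.log (16 * a ^ 2) := by
          refine Real.log_le_log (by positivity) ?_
          rw [div_le_iff₀ (by positivity)]
          have : 16 * a ^ 2 * (4 * y ^ 3 / (a ^ 2 * k)) = 64 * y ^ 3 / k := by field_simp; ring
          rw [this, le_div_iff₀ hk0]
          push_cast
          nlinarith
        linarith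
  have hsplit : ∑ k ∈ Icc 1 ⌊y⌋₊, (if (k : ℝ) ≤ κ then 64 * κ ^ 2 else G k) ≤
      ∑ k ∈ Icc 1 ⌊κ⌋₊, 64 * κ ^ 2 + ∑ k ∈ Ioc ⌊κ⌋₊ ⌊y⌋₊, G k := by
    have hle : ⌊κ⌋₊ ≤ ⌊y⌋₊ := Nat.floor_le_floor hκy
    have hunion : Icc 1 ⌊y⌋₊ = Icc 1 ⌊κ⌋₊ ∪ Ioc ⌊κ⌋₊ ⌊y⌋₊ := by
      ext i; simp only [mem_Icc, mem_union, mem_Ioc]; omega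
    have hdisj : Disjoint (Icc 1 ⌊κ⌋₊) (Ioc ⌊κ⌋₊ ⌊y⌋₊) := disjoint_left.2 fun i => by
      simp only [mem_Icc, mem_Ioc]; omega
    rw [hunion, sum_union hdisj]
    refine add_le_add (sum_le_sum fun k hk => ?_) (sum_le_sum fun k hk => ?_)
    · rw [if_pos ((Nat.le_floor_iff hκ.le).1 (mem_Icc.1 hk).2)]
    · rw [if_neg (not_le.2 ((Nat.floor_lt hκ.le).1 (mem_Ioc.1 hk).1))]
  have h1 : ∑ k ∈ Icc 1 ⌊κ⌋₊, 64 * κ ^ 2 ≤ 4 * (y ^ 3 / a ^ 2) := by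
    rw [sum_const, Nat.card_Icc, Nat.add_sub_cancel, nsmul_eq_mul]
    calc _ ≤ κ * (64 * κ ^ 2) := by gcongr; exact Nat.floor_le hκ.le
      _ = 64 * κ ^ 3 := by ring
      _ = _ := by rw [hκ3]; field_simp; norm_num
  have h2 : ∑ k ∈ Ioc ⌊κ⌋₊ ⌊y⌋₊, G k ≤ (4 * y ^ 3 / a ^ 2 * (6 * L)) * (6 * L) := by
    have heq : ∑ k ∈ Ioc ⌊κ⌋₊ ⌊y⌋₊, G k =
        (4 * y ^ 3 / a ^ 2 * (6 * L)) * ∑ k ∈ Ioc ⌊κ⌋₊ ⌊y⌋₊, (1 / k : ℝ) := by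
      rw [mul_sum]
      exact sum_congr rfl fun k _ => by simp only [hG, div_eq_mul_inv, mul_inv]; ring
    rw [heq]
    gcongr
    rcases le_or_gt κ ⌊y⌋₊ with hle | hlt
    · refine (sum_Ioc_floor_inv_le hκ hle).trans ?_
      have : Real.log (⌊y⌋₊ / κ) ≤ Real.log (16 * a ^ 2) := by
        refine Real.log_le_log (div_pos (hκ.trans_le hle) hκ) ?_
        have h1 : (⌊y⌋₊ : ℝ) / κ ≤ y / κ := by gcongr; exact Nat.floor_le (by linarith)
        have h2 : 1 ≤ y / κ := (one_le_div hκ).2 hκy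
        have h3 : (y / κ) ^ 3 = 16 * a ^ 2 := by
          rw [div_pow, hκ3]; field_simp
        have h4 : y / κ ≤ (y / κ) ^ 3 := le_self_pow₀ h2 (by norm_num)
        linarith
      linarith
    · have : Ioc ⌊κ⌋₊ ⌊y⌋₊ = ∅ := by
        rw [Ioc_eq_empty_iff, not_lt]
        exact Nat.le_floor hlt.le
      rw [this, sum_empty]
      positivity
  have h3 := (sum_le_sum hterm).trans (hsplit.trans (add_le_add h1 h2))
  refine h3.trans ?_
  have h4 : 0 ≤ y ^ 3 / a ^ 2 := by positivity
  have : 4 * (y ^ 3 / a ^ 2) + 4 * y ^ 3 / a ^ 2 * (6 * L) * (6 * L) =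
    (4 + 144 * L ^ 2) * (y ^ 3 / a ^ 2) := by ring
  rw [this]
  calc (4 + 144 * L ^ 2) * (y ^ 3 / a ^ 2) ≤ (160 * L ^ 2) * (y ^ 3 / a ^ 2) := by
        gcongr; nlinarith
    _ = _ := by ring

/-- The region of `(i, j, k) ∈ ℕ³` dominating the count of balanced lattice points. -/
def region (a x : ℝ) : Set (ℕ × ℕ × ℕ) :=
  {n | (n.2.2 : ℝ) ^ 3 ≤ x ∧ (n.2.2 : ℝ) ^ 2 * (a * n.1) ≤ 2 * x ∧
    (n.2.2 : ℝ) ^ 2 * (a * n.2.1) ≤ 2 * x ∧ (n.2.2 : ℝ) * (a * n.1) * (a * n.2.1) ≤ 4 * x ∧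
    n.1 < 4 * (n.2.2 + 1) ∧ n.2.1 < 4 * (n.2.2 + 1)}

lemma exists_finset_region {a y Y : ℝ} (ha : 8 ≤ a) (hy : 1 ≤ y) (hY : 0 < Y)
    (hYy : Y ^ 3 = y ^ 3 / a) :
    ∃ W : Finset (ℕ × ℕ × ℕ), region a (y ^ 3) ⊆ W ∧
      (#W : ℝ) ≤ 160 * (Real.log a ^ 2 * y ^ 3 / a ^ 2) + 24 * Y ^ 2 + 18 * y := by
  classical
  have ha0 : 0 < a := by linarith
  set N := ⌊y⌋₊ with hN
  set V : ℕ → Finset ℕ := fun k => Icc 1 (min (8 * k) ⌊2 * Y ^ 3 / (k : ℝ) ^ 2⌋₊) with hV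
  set T : ℕ → Finset (ℕ × ℕ) := fun k => {p ∈ Icc 1 (8 * k) ×ˢ Icc 1 (8 * k) |
      (p.1 * p.2 : ℝ) ≤ 4 * y ^ 3 / (a ^ 2 * k)} with hT
  set W₀ : Finset (ℕ × ℕ × ℕ) := range 4 ×ˢ range 4 ×ˢ {0} with hW₀
  set W₁ : Finset (ℕ × ℕ × ℕ) := (Icc 1 N).image fun k => (0, 0, k) with hW₁
  set W₂ : Finset (ℕ × ℕ × ℕ) := (Icc 1 N).biUnion fun k => (V k).image fun i => (i, 0, k) with hW₂
  set W₃ : Finset (ℕ × ℕ × ℕ) := (Icc 1 N).biUnion fun k => (V k).image fun i => (0, i, k) with hW₃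
  set W₄ : Finset (ℕ × ℕ × ℕ) :=
    (Icc 1 N).biUnion fun k => (T k).image fun p => (p.1, p.2, k) with hW₄
  have hVcard : ∑ k ∈ Icc 1 N, (#(V k) : ℝ) ≤ 12 * Y ^ 2 := by
    refine (sum_le_sum fun k _ => ?_).trans (card_sq_region_le hY N)
    rw [hV, Nat.card_Icc, Nat.add_sub_cancel, Nat.cast_min]
    push_cast
    exact min_le_min le_rfl (Nat.floor_le (by positivity))
  have hNy : (N : ℝ) ≤ y := Nat.floor_le (by linarith)
  have c₀ : #W₀ = 16 := by simp [hW₀]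
  have c₁ : (#W₁ : ℝ) ≤ y := by
    refine (Nat.cast_le.2 card_image_le).trans ?_
    rwa [Nat.card_Icc, Nat.add_sub_cancel]
  have c₂ : (#W₂ : ℝ) ≤ 12 * Y ^ 2 := by
    refine (Nat.cast_le.2 card_biUnion_le).trans ?_
    push_cast
    exact (sum_le_sum fun k _ => Nat.cast_le.2 card_image_le).trans hVcard
  have c₃ : (#W₃ : ℝ) ≤ 12 * Y ^ 2 := by
    refine (Nat.cast_le.2 card_biUnion_le).trans ?_
    push_cast
    exact (sum_le_sum fun k _ => Nat.cast_le.2 card_image_le).trans hVcard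
  have c₄ : (#W₄ : ℝ) ≤ 160 * (Real.log a ^ 2 * y ^ 3 / a ^ 2) := by
    refine (Nat.cast_le.2 card_biUnion_le).trans ?_
    push_cast
    exact (sum_le_sum fun k _ => Nat.cast_le.2 card_image_le).trans (sum_card_hyperbola_le ha hy)
  refine ⟨W₀ ∪ (W₁ ∪ (W₂ ∪ (W₃ ∪ W₄))), ?_, ?_⟩
  · rintro ⟨i, j, k⟩ ⟨h1, h2, h3, h4, h5, h6⟩
    simp only at h1 h2 h3 h4 h5 h6
    simp only [coe_union, Set.mem_union, mem_coe]
    rcases Nat.eq_zero_or_pos k with rfl | hk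
    · left
      simp only [hW₀, mem_product, mem_range, mem_singleton]
      exact ⟨by omega, by omega, trivial⟩
    have hk0 : (0 : ℝ) < k := by exact_mod_cast hk
    have hkN : k ∈ Icc 1 N := mem_Icc.2 ⟨hk, Nat.le_floor
      (le_of_pow_le_pow_left₀ (n := 3) (by norm_num) (by linarith) h1)⟩
    have hmemV : ∀ i : ℕ, 1 ≤ i → (k : ℝ) ^ 2 * (a * i) ≤ 2 * y ^ 3 → i < 4 * (k + 1) →
        i ∈ V k := by
      intro i hi hi' hi''
      refine mem_Icc.2 ⟨hi, le_min (by omega) (Nat.le_floor ?_)⟩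
      rw [le_div_iff₀ (by positivity), hYy, mul_div_assoc', le_div_iff₀ ha0]
      linarith
    rcases Nat.eq_zero_or_pos i with rfl | hi
    · rcases Nat.eq_zero_or_pos j with rfl | hj
      · right; left
        exact mem_image.2 ⟨k, hkN, rfl⟩
      · right; right; right; left
        exact mem_biUnion.2 ⟨k, hkN, mem_image.2 ⟨j, hmemV j hj h3 h6, rfl⟩⟩
    · rcases Nat.eq_zero_or_pos j with rfl | hj
      · right; right; left
        exact mem_biUnion.2 ⟨k, hkN, mem_image.2 ⟨i, hmemV i hi h2 h5, rfl⟩⟩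
      · right; right; right; right
        refine mem_biUnion.2 ⟨k, hkN, mem_image.2 ⟨(i, j), ?_, rfl⟩⟩
        simp only [hT, mem_filter, mem_product, mem_Icc]
        refine ⟨by omega, ?_⟩
        rw [le_div_iff₀ (by positivity)]
        linarith
  · have hc : #(W₀ ∪ (W₁ ∪ (W₂ ∪ (W₃ ∪ W₄)))) ≤ #W₀ + (#W₁ + (#W₂ + (#W₃ + #W₄))) := by
      refine (card_union_le _ _).trans (Nat.add_le_add_left ?_ _)
      refine (card_union_le _ _).trans (Nat.add_le_add_left ?_ _)
      refine (card_union_le _ _).trans (Nat.add_le_add_left ?_ _)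
      exact card_union_le _ _
    have hc' : (#(W₀ ∪ (W₁ ∪ (W₂ ∪ (W₃ ∪ W₄)))) : ℝ) ≤ #W₀ + (#W₁ + (#W₂ + (#W₃ + #W₄))) := by
      exact_mod_cast hc
    rw [c₀] at hc'
    push_cast at hc'
    linarith

end Counting

section UpperBound

lemma abs_sub_lt_one_of_floor_abs_eq {x y : ℝ} (h : 0 ≤ x ↔ 0 ≤ y) (hf : ⌊|x|⌋₊ = ⌊|y|⌋₊) :
    |x - y| < 1 := by
  have h1 := Nat.floor_le (abs_nonneg x)
  have h2 := Nat.lt_floor_add_one |x|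
  have h3 := Nat.floor_le (abs_nonneg y)
  have h4 := Nat.lt_floor_add_one |y|
  rw [hf] at h1 h2
  rw [abs_lt]
  by_cases hx : 0 ≤ x
  · rw [abs_of_nonneg hx] at h1 h2
    rw [abs_of_nonneg (h.1 hx)] at *
    constructor <;> linarith
  · rw [abs_of_neg (not_le.1 hx)] at h1 h2
    rw [abs_of_neg (not_le.1 (mt h.2 hx))] at *
    constructor <;> linarith

/-- The lattice points whose three conjugates are balanced and have product at most `x`. -/
def balancedPoints (a r s t x : ℝ) : Set (ℤ × ℤ × ℤ) :=
  {n | Balanced a (emb r s n) (emb s t n) (emb t r n) ∧ |emb r s n * emb s t n * emb t r n| ≤ x}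

lemma RootTriple.encard_min_le {a r s t x : ℝ} (h : RootTriple a r s t)
    {W : Finset (ℕ × ℕ × ℕ)} (hW : region a x ⊆ W) :
    {n ∈ balancedPoints a r s t x | |emb s t n| ≤ |emb r s n| ∧ |emb s t n| ≤ |emb t r n|}.encard ≤
      8 * W.card := by
  have ha := h.eight_le
  have ha0 : 0 < a := by linarith
  let p : ℤ × ℤ × ℤ → ℝ := fun n => (emb r s n - emb s t n) / a
  let q : ℤ × ℤ × ℤ → ℝ := fun n => (emb t r n - emb s t n) / a
  let c : ℤ × ℤ × ℤ → (Bool × Bool × Bool) × (ℕ × ℕ × ℕ) := fun n =>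
    ((decide (0 ≤ p n), decide (0 ≤ q n), decide (0 ≤ emb s t n)),
      (⌊|p n|⌋₊, ⌊|q n|⌋₊, ⌊|emb s t n|⌋₊))
  have hinj : Function.Injective c := by
    intro m n hmn
    simp only [c, Prod.mk.injEq, decide_eq_decide] at hmn
    obtain ⟨⟨h1, h2, h3⟩, h4, h5, h6⟩ := hmn
    have hp := abs_sub_lt_one_of_floor_abs_eq h1 h4
    have hq := abs_sub_lt_one_of_floor_abs_eq h2 h5
    have hz := abs_sub_lt_one_of_floor_abs_eq h3 h6
    simp only [p, q, ← sub_div, abs_div, abs_of_pos ha0, div_lt_one ha0] at hp hq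
    refine sub_eq_zero.1 (h.eq_zero_of_abs_lt ?_ ?_ ?_)
    · rw [emb_sub, emb_sub]; rwa [sub_sub_sub_comm] at hp
    · rw [emb_sub, emb_sub]; rwa [sub_sub_sub_comm] at hq
    · rwa [emb_sub]
  calc _ ≤ ((Finset.univ ×ˢ W : Finset ((Bool × Bool × Bool) × (ℕ × ℕ × ℕ))) : Set _).encard := by
        refine Set.encard_le_encard_of_injOn (f := c) ?_ hinj.injOn
        rintro n ⟨⟨hbal, hx⟩, h1, h3⟩
        have hreg : (c n).2 ∈ region a x := by
          rw [abs_mul, abs_mul] at hx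
          have hb := hbal.1
          have hb' := hbal.2.2.2.2.2
          have hp : a * ⌊|p n|⌋₊ ≤ |emb r s n| + |emb s t n| := by
            have h1 : |p n| = |emb r s n - emb s t n| / a := by
              simp only [p, abs_div, abs_of_pos ha0]
            have h2 := (le_div_iff₀ ha0).1 ((Nat.floor_le (abs_nonneg (p n))).trans_eq h1)
            linarith [abs_sub (emb r s n) (emb s t n)]
          have hq : a * ⌊|q n|⌋₊ ≤ |emb t r n| + |emb s t n| := by
            have h1 : |q n| = |emb t r n - emb s t n| / a := by
              simp only [q, abs_div, abs_of_pos ha0]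
            have h2 := (le_div_iff₀ ha0).1 ((Nat.floor_le (abs_nonneg (q n))).trans_eq h1)
            linarith [abs_sub (emb t r n) (emb s t n)]
          have hk := Nat.floor_le (abs_nonneg (emb s t n))
          have hk' := Nat.lt_floor_add_one |emb s t n|
          simp only [region, Set.mem_ofPred_eq, c]
          generalize ⌊|p n|⌋₊ = i at *
          generalize ⌊|q n|⌋₊ = j at *
          generalize ⌊|emb s t n|⌋₊ = k at *
          have hX := abs_nonneg (emb r s n)
          have hZ := abs_nonneg (emb s t n)
          have hY := abs_nonneg (emb t r n)
          generalize |emb r s n| = X at *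
          generalize |emb s t n| = Z at *
          generalize |emb t r n| = Y at *
          have hk0 : (0 : ℝ) ≤ k := k.cast_nonneg
          have hp' : a * i ≤ 2 * X := by linarith
          have hq' : a * j ≤ 2 * Y := by linarith
          have lt_of_le : ∀ i : ℕ, a * i ≤ (2 * a + 1) * Z → i < 4 * (k + 1) := by
            intro i hi
            have h1 : a * i ≤ a * (3 * Z) := by nlinarith
            have h2 : (i : ℝ) ≤ 3 * Z := le_of_mul_le_mul_left h1 ha0
            have h3 : (i : ℝ) < 4 * (k + 1) := by linarith
            exact_mod_cast h3
          refine ⟨?_, ?_, ?_, ?_, lt_of_le i (by linarith), lt_of_le j (by linarith)⟩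
          · calc (k : ℝ) ^ 3 = k * k * k := by ring
              _ ≤ X * Z * Y := by gcongr <;> linarith
              _ ≤ x := hx
          · calc (k : ℝ) ^ 2 * (a * i) ≤ k ^ 2 * (2 * X) := by gcongr
              _ = 2 * (X * k * k) := by ring
              _ ≤ 2 * (X * Z * Y) := by gcongr; linarith
              _ ≤ 2 * x := by gcongr
          · calc (k : ℝ) ^ 2 * (a * j) ≤ k ^ 2 * (2 * Y) := by gcongr
              _ = 2 * (k * k * Y) := by ring
              _ ≤ 2 * (X * Z * Y) := by gcongr; linarith
              _ ≤ 2 * x := by gcongr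
          · calc (k : ℝ) * (a * i) * (a * j) ≤ Z * (2 * X) * (2 * Y) := by gcongr
              _ = 4 * (X * Z * Y) := by ring
              _ ≤ 4 * x := by gcongr
        exact Finset.mem_coe.2 (Finset.mem_product.2 ⟨Finset.mem_univ _, hW hreg⟩)
    _ = 8 * W.card := by
        rw [Set.encard_coe_eq_coe_finsetCard, Finset.card_product]
        norm_num

lemma RootTriple.encard_balancedPoints_le {a : ℤ} {r s t x : ℝ} (h : RootTriple a r s t)
    {W : Finset (ℕ × ℕ × ℕ)} (hW : region a x ⊆ W) :
    (balancedPoints a r s t x).encard ≤ 24 * W.card := by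
  set A : Set (ℤ × ℤ × ℤ) :=
    {n ∈ balancedPoints a r s t x | |emb s t n| ≤ |emb r s n| ∧ |emb s t n| ≤ |emb t r n|} with hA
  have hAcard : A.encard ≤ 8 * W.card := h.encard_min_le hW
  let T : ℤ × ℤ × ℤ → ℤ × ℤ × ℤ := fun n => (n.1 + a * n.2.2, -n.2.2, n.2.1 - n.2.2)
  have hT : Function.Injective T := by
    rintro ⟨u, v, w⟩ ⟨u', v', w'⟩ heq
    simp only [T, Prod.mk.injEq] at heq
    obtain ⟨h1, h2, h3⟩ := heq
    obtain rfl : w = w' := by linarith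
    simp only [Prod.mk.injEq]
    exact ⟨by linarith, by linarith, trivial⟩
  have hsum : (a : ℝ) = r + s + t := h.sum_eq.symm
  have hT₁ : ∀ n, emb r s (T n) = emb s t n := fun n => by
    simp only [emb, T]; push_cast; rw [hsum]; ring
  have hT₂ : ∀ n, emb s t (T n) = emb t r n := fun n => by
    simp only [emb, T]; push_cast; rw [hsum]; ring
  have hT₃ : ∀ n, emb t r (T n) = emb r s n := fun n => by
    simp only [emb, T]; push_cast; rw [hsum]; ring
  have hTD : ∀ n ∈ balancedPoints a r s t x, T n ∈ balancedPoints a r s t x := by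
    rintro n ⟨⟨h1, h2, h3, h4, h5, h6⟩, hx⟩
    simp only [balancedPoints, Balanced, Set.mem_ofPred_eq, hT₁, hT₂, hT₃]
    refine ⟨⟨h4, h3, h6, h5, h1, h2⟩, ?_⟩
    convert hx using 2
    ring
  have hcover : balancedPoints a r s t x ⊆ A ∪ (T ⁻¹' A ∪ (T ∘ T) ⁻¹' A) := by
    intro n hn
    by_cases h2 : |emb s t n| ≤ |emb r s n| ∧ |emb s t n| ≤ |emb t r n|
    · exact Or.inl ⟨hn, h2⟩
    by_cases h3 : |emb t r n| ≤ |emb s t n| ∧ |emb t r n| ≤ |emb r s n|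
    · exact Or.inr (Or.inl ⟨hTD n hn, by rwa [hT₁, hT₂, hT₃]⟩)
    · refine Or.inr (Or.inr ⟨hTD _ (hTD n hn), ?_⟩)
      simp only [Function.comp_apply, hT₁, hT₂, hT₃]
      grind
  have h₁ : (T ⁻¹' A).encard ≤ A.encard :=
    Set.encard_le_encard_of_injOn (Set.mapsTo_preimage T A) hT.injOn
  have h₂ : ((T ∘ T) ⁻¹' A).encard ≤ A.encard :=
    Set.encard_le_encard_of_injOn (Set.mapsTo_preimage (T ∘ T) A) (hT.comp hT).injOn
  calc _ ≤ _ := Set.encard_le_encard hcover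
    _ ≤ A.encard + (A.encard + A.encard) := by
        refine (Set.encard_union_le _ _).trans (add_le_add le_rfl ?_)
        exact (Set.encard_union_le _ _).trans (add_le_add h₁ h₂)
    _ ≤ 8 * W.card + (8 * W.card + 8 * W.card) := by gcongr
    _ = 24 * W.card := by ring

/-- The nonzero principal ideals of absolute norm at most `x`. -/
abbrev principalIdeals (K : Type*) [Field K] [NumberField K] (x : ℝ) : Set (Ideal (𝓞 K)) :=
  {I | I ≠ ⊥ ∧ Submodule.IsPrincipal I ∧ (Ideal.absNorm I : ℝ) ≤ x}

lemma IsModel.ncard_principalIdeals_le {a : ℤ} {K : Type*} [Field K] [NumberField K]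
    {r s t x : ℝ} {Φ : ℤ × ℤ × ℤ → 𝓞 K} {e₁ e₂ e₃ : 𝓞 K →+* ℝ}
    (hM : IsModel r s t Φ e₁ e₂ e₃) (h : RootTriple a r s t)
    {W : Finset (ℕ × ℕ × ℕ)} (hW : region a x ⊆ W) :
    (principalIdeals K x).ncard ≤ 24 * W.card := by
  rw [Set.ncard_def]
  refine ENat.toNat_le_of_le_natCast ?_
  push_cast
  refine le_trans ?_ (h.encard_balancedPoints_le hW)
  refine (Set.encard_le_encard ?_).trans
    (Set.encard_image_le (fun n => Ideal.span {Φ n}) (balancedPoints a r s t x))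
  rintro I ⟨-, hI, hIx⟩
  obtain ⟨n, rfl, hn⟩ := hM.exists_balanced h hI
  refine ⟨n, ⟨hn, ?_⟩, rfl⟩
  rwa [hM.absNorm_span, hM.emb₁, hM.emb₂, hM.emb₃] at hIx

end UpperBound

section LowerBound

open Finset

lemma encard_band_le (x y : ℝ) (B : ℕ) :
    {m : ℤ × ℤ × ℤ | |m.2.1| ≤ B ∧ |m.2.2| ≤ B ∧ |emb x y m| ≤ 1}.encard ≤
      ((3 * (2 * B + 1) ^ 2 : ℕ) : ℕ∞) := by
  classical
  have hsub : {m : ℤ × ℤ × ℤ | |m.2.1| ≤ B ∧ |m.2.2| ≤ B ∧ |emb x y m| ≤ 1} ⊆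
      ((Icc (-1 : ℤ) 1 ×ˢ Icc (-B : ℤ) B ×ˢ Icc (-B : ℤ) B).image fun k =>
        (k.1 + ⌊-(k.2.1 * x + k.2.2 * y)⌋, k.2) : Finset (ℤ × ℤ × ℤ)) := by
    rintro ⟨u, v, w⟩ ⟨hv, hw, hu⟩
    simp only [emb] at hv hw hu
    rw [abs_le] at hu
    set θ := -((v : ℝ) * x + w * y) with hθ
    have h1 := Int.floor_le θ
    have h2 := Int.lt_floor_add_one θ
    have h3 : ((u - ⌊θ⌋ : ℤ) : ℝ) < (2 : ℤ) := by push_cast; linarith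
    have h4 : ((-2 : ℤ) : ℝ) < (u - ⌊θ⌋ : ℤ) := by push_cast; linarith
    have h3' := Int.cast_lt.1 h3
    have h4' := Int.cast_lt.1 h4
    refine mem_coe.2 (mem_image.2 ⟨(u - ⌊θ⌋, v, w), ?_, by simp [hθ]⟩)
    simp only [mem_product, mem_Icc]
    exact ⟨by omega, abs_le.1 hv, abs_le.1 hw⟩
  refine (Set.encard_le_encard hsub).trans ?_
  rw [Set.encard_coe_eq_coe_finsetCard, Nat.cast_le]
  refine card_image_le.trans ?_
  rw [card_product, card_product, Int.card_Icc, Int.card_Icc]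
  apply le_of_eq
  rw [show ((B : ℤ) + 1 - -B).toNat = 2 * B + 1 by omega]
  rw [show ((1 : ℤ) + 1 - -1).toNat = 3 from rfl]
  ring

variable {a r s t : ℝ}

lemma RootTriple.encard_units_le (h : RootTriple a r s t) (C : ℕ) :
    {m : ℤ × ℤ × ℤ | |emb r s m| ≤ C * a ∧ |emb s t m| ≤ C * a ∧ |emb t r m| ≤ C * a ∧
      |emb r s m * emb s t m * emb t r m| ≤ 1}.encard ≤ ((9 * (8 * C + 1) ^ 2 : ℕ) : ℕ∞) := by
  have ha : 0 < a := by linarith [h.eight_le]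
  let U : ℝ → ℝ → Set (ℤ × ℤ × ℤ) := fun x y =>
    {m | |m.2.1| ≤ (4 * C : ℕ) ∧ |m.2.2| ≤ (4 * C : ℕ) ∧ |emb x y m| ≤ 1}
  have hsub : {m : ℤ × ℤ × ℤ | |emb r s m| ≤ C * a ∧ |emb s t m| ≤ C * a ∧ |emb t r m| ≤ C * a ∧
      |emb r s m * emb s t m * emb t r m| ≤ 1} ⊆ U r s ∪ (U s t ∪ U t r) := by
    rintro m ⟨h1, h2, h3, h4⟩
    obtain ⟨hv, hw⟩ := h.abs_mul_le_and m
    have h5 := abs_sub (emb r s m) (emb s t m)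
    have h6 := abs_sub (emb t r m) (emb s t m)
    have key : ∀ v : ℤ, |(v : ℝ)| * a ≤ |emb r s m - emb s t m| + |emb t r m - emb s t m| →
        |v| ≤ (4 * C : ℕ) := by
      intro v hv
      have : |(v : ℝ)| ≤ 4 * C := le_of_mul_le_mul_right (by linarith) ha
      exact_mod_cast this
    have hv' := key _ hv
    have hw' := key _ hw
    by_contra! hcon
    have h7 : 1 < |emb r s m| := by
      by_contra! hle
      exact hcon (Or.inl ⟨hv', hw', hle⟩)
    have h8 : 1 < |emb s t m| := by
      by_contra! hle
      exact hcon (Or.inr (Or.inl ⟨hv', hw', hle⟩))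
    have h9 : 1 < |emb t r m| := by
      by_contra! hle
      exact hcon (Or.inr (Or.inr ⟨hv', hw', hle⟩))
    rw [abs_mul, abs_mul] at h4
    exact h4.not_gt (one_lt_mul_of_lt_of_le (one_lt_mul_of_lt_of_le h7 h8.le) h9.le)
  calc _ ≤ _ := Set.encard_le_encard hsub
    _ ≤ _ := (Set.encard_union_le _ _).trans (add_le_add le_rfl (Set.encard_union_le _ _))
    _ ≤ _ := add_le_add (encard_band_le _ _ _)
        (add_le_add (encard_band_le _ _ _) (encard_band_le _ _ _))
    _ = _ := by
        rw [← Nat.cast_add, ← Nat.cast_add, Nat.cast_inj]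
        ring

variable {K : Type*} [Field K] [NumberField K] {Φ : ℤ × ℤ × ℤ → 𝓞 K} {e₁ e₂ e₃ : 𝓞 K →+* ℝ}

lemma finite_principalIdeals (x : ℝ) : (principalIdeals K x).Finite :=
  (Ideal.finite_setOfPred_absNorm_le (S := 𝓞 K) ⌊x⌋₊).subset fun _ hI => Nat.le_floor hI.2.2

lemma IsModel.injective (hM : IsModel r s t Φ e₁ e₂ e₃) (h : RootTriple a r s t) :
    Function.Injective Φ := by
  intro m n hmn
  have h1 : emb r s m = emb r s n := by rw [← hM.emb₁, hmn, hM.emb₁]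
  have h2 : emb s t m = emb s t n := by rw [← hM.emb₂, hmn, hM.emb₂]
  have h3 : emb t r m = emb t r n := by rw [← hM.emb₃, hmn, hM.emb₃]
  have ha : 0 < a := by linarith [h.eight_le]
  refine sub_eq_zero.1 (h.eq_zero_of_abs_lt ?_ ?_ ?_) <;> simp [emb_sub, h1, h2, h3, ha]

lemma IsModel.card_le_mul_ncard (hM : IsModel r s t Φ e₁ e₂ e₃) (h : RootTriple a r s t)
    {S : Finset (ℤ × ℤ × ℤ)} {x l₁ l₂ l₃ : ℝ} {C : ℕ} (hl₁ : 0 < l₁) (hl₂ : 0 < l₂) (hl₃ : 0 < l₃)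
    (h₁ : ∀ n ∈ S, l₁ ≤ emb r s n ∧ emb r s n ≤ C * a * l₁)
    (h₂ : ∀ n ∈ S, l₂ ≤ emb s t n ∧ emb s t n ≤ C * a * l₂)
    (h₃ : ∀ n ∈ S, l₃ ≤ emb t r n ∧ emb t r n ≤ C * a * l₃)
    (hx : ∀ n ∈ S, emb r s n * emb s t n * emb t r n ≤ x) :
    #S ≤ 9 * (8 * C + 1) ^ 2 * (principalIdeals K x).ncard := by
  classical
  have ha : 0 < a := by linarith [h.eight_le]
  have hfin := finite_principalIdeals (K := K) x
  rw [Set.ncard_eq_toFinset_card _ hfin]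
  refine card_le_mul_card_image_of_maps_to (f := fun n => Ideal.span {Φ n}) (fun n hn => ?_) _ ?_
  · have p₁ := hl₁.trans_le (h₁ n hn).1
    have p₂ := hl₂.trans_le (h₂ n hn).1
    have p₃ := hl₃.trans_le (h₃ n hn).1
    refine hfin.mem_toFinset.2 ⟨?_, ⟨Φ n, rfl⟩, ?_⟩
    · rw [Ne, Ideal.span_singleton_eq_bot]
      intro h0
      rw [← hM.emb₁, h0, map_zero] at p₁
      exact p₁.ne rfl
    · rw [hM.absNorm_span, hM.emb₁, hM.emb₂, hM.emb₃, abs_of_pos (by positivity)]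
      exact hx n hn
  intro I _
  rcases ({n ∈ S | Ideal.span {Φ n} = I} : Finset _).eq_empty_or_nonempty with he | ⟨n₀, hn₀⟩
  · rw [he, card_empty]; exact Nat.zero_le _
  obtain ⟨hn₀S, rfl⟩ := mem_filter.1 hn₀
  rw [← Nat.cast_le (α := ℕ∞), ← Set.encard_coe_eq_coe_finsetCard]
  refine le_trans ?_ (h.encard_units_le C)
  refine (Set.encard_le_encard ?_).trans
    (Set.encard_image_le (fun m => Function.surjInv hM.surjective (Φ m * Φ n₀)) _)
  intro n hn
  obtain ⟨hn, hspan⟩ := mem_filter.1 (mem_coe.1 hn)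
  obtain ⟨ε, hε⟩ := Ideal.span_singleton_eq_span_singleton.1 hspan.symm
  obtain ⟨m, hm⟩ := hM.surjective ε
  have hmn : Φ m * Φ n₀ = Φ n := by rw [hm, mul_comm, hε]
  have bound : ∀ {α β γ l : ℝ}, 0 < l → α * β = γ → l ≤ β → l ≤ γ → γ ≤ C * a * l →
      |α| ≤ C * a := by
    intro α β γ l hl hαβ hβ hγ hγ'
    have hβ0 := hl.trans_le hβ
    have hα : 0 < α := by
      by_contra! hle
      nlinarith
    rw [abs_of_pos hα]
    by_contra! hlt
    have : C * a * l < α * β := by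
      calc _ < α * l := by gcongr
        _ ≤ _ := by gcongr
    linarith
  refine ⟨m, ⟨?_, ?_, ?_, ?_⟩, ?_⟩
  · refine bound hl₁ ?_ (h₁ n₀ hn₀S).1 (h₁ n hn).1 (h₁ n hn).2
    rw [← hM.emb₁, ← hM.emb₁, ← hM.emb₁, ← map_mul, hmn]
  · refine bound hl₂ ?_ (h₂ n₀ hn₀S).1 (h₂ n hn).1 (h₂ n hn).2
    rw [← hM.emb₂, ← hM.emb₂, ← hM.emb₂, ← map_mul, hmn]
  · refine bound hl₃ ?_ (h₃ n₀ hn₀S).1 (h₃ n hn).1 (h₃ n hn).2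
    rw [← hM.emb₃, ← hM.emb₃, ← hM.emb₃, ← map_mul, hmn]
  · rw [← hM.emb₁, ← hM.emb₂, ← hM.emb₃, ← hM.absNorm_span, hm,
      Ideal.span_singleton_eq_top.2 ε.isUnit]
    simp
  · simp only [hmn]
    exact hM.injective h (Function.surjInv_eq hM.surjective _)

lemma IsModel.le_ncard (hM : IsModel r s t Φ e₁ e₂ e₃) {y : ℝ} (hy : 1 ≤ y) :
    y ≤ 2 * (principalIdeals K (y ^ 3)).ncard := by
  have hnorm : ∀ k : ℕ, (Ideal.absNorm (Ideal.span {(k : 𝓞 K)}) : ℝ) = (k : ℝ) ^ 3 := fun k => by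
    rw [hM.absNorm_span, map_natCast, map_natCast, map_natCast, abs_of_nonneg (by positivity)]
    ring
  have hcard : ⌊y⌋₊ ≤ (principalIdeals K (y ^ 3)).ncard := by
    have h1 : Set.InjOn (fun k : ℕ => Ideal.span {(k : 𝓞 K)}) (Icc 1 ⌊y⌋₊ : Finset ℕ) := by
      intro k _ l _ hkl
      have : (k : ℝ) ^ 3 = (l : ℝ) ^ 3 := by rw [← hnorm, ← hnorm]; simp only at hkl; rw [hkl]
      exact Nat.pow_left_injective three_ne_zero (by exact_mod_cast this)
    have h2 := Set.ncard_le_ncard_of_injOn (t := principalIdeals K (y ^ 3)) _ ?_ h1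
      (finite_principalIdeals _)
    · rwa [Set.ncard_coe_finset, Nat.card_Icc, Nat.add_sub_cancel] at h2
    · intro k hk
      obtain ⟨hk1, hk2⟩ := mem_Icc.1 (mem_coe.1 hk)
      refine ⟨?_, ⟨k, rfl⟩, ?_⟩
      · rw [Ne, Ideal.span_singleton_eq_bot, Nat.cast_eq_zero]
        omega
      · rw [hnorm]
        have := (Nat.le_floor_iff (by linarith)).1 hk2
        gcongr
  have h1 : (⌊y⌋₊ : ℝ) ≤ (principalIdeals K (y ^ 3)).ncard := by exact_mod_cast hcard
  have h2 : (1 : ℝ) ≤ ⌊y⌋₊ := by exact_mod_cast Nat.le_floor (by simpa using hy)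
  linarith [Nat.lt_floor_add_one y]

lemma IsModel.sq_le_ncard (hM : IsModel r s t Φ e₁ e₂ e₃) (h : RootTriple a r s t) {Y : ℝ}
    (hY : 4 ≤ Y) : Y ^ 2 ≤ 166464 * (principalIdeals K (a * Y ^ 3)).ncard := by
  have ha := h.eight_le
  have hr := h.lt_r
  have hr' := h.r_lt
  have hs := h.s_neg
  have hs' := h.neg_s_lt
  have ht := h.t_lt
  have ht' := h.lt_t
  set T := ⌊Y / 4⌋₊ with hT
  have hT1 : 1 ≤ T := Nat.le_floor (by push_cast; linarith)
  have hT1' : (1 : ℝ) ≤ T := by exact_mod_cast hT1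
  have hTY : (T : ℝ) ≤ Y / 4 := Nat.floor_le (by linarith)
  have hYT : Y ≤ 8 * T := by linarith [Nat.lt_floor_add_one (Y / 4)]
  let S : Finset (ℤ × ℤ × ℤ) := (Ico (4 * T : ℤ) (5 * T)) ×ˢ (Icc (1 : ℤ) T) ×ˢ {0}
  have hS : #S = T ^ 2 := by
    simp only [S, card_product, Int.card_Ico, Int.card_Icc, card_singleton]
    rw [show ((5 : ℤ) * T - 4 * T).toNat = T by omega, show ((T : ℤ) + 1 - 1).toNat = T by omega]
    ring
  have hmem : ∀ n ∈ S, ∃ u v : ℝ, 4 * (T : ℝ) ≤ u ∧ u ≤ 5 * T ∧ 0 ≤ v ∧ v ≤ T ∧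
      ∀ x y, emb x y n = u + v * x := by
    rintro ⟨u, v, w⟩ hn
    simp only [S, mem_product, mem_Ico, mem_Icc, mem_singleton] at hn
    obtain ⟨⟨h1, h2⟩, ⟨h3, h4⟩, rfl⟩ := hn
    refine ⟨u, v, by exact_mod_cast h1, by exact_mod_cast h2.le, by exact_mod_cast (by omega),
      by exact_mod_cast h4, fun x y => by simp [emb]⟩
  have b₁ : ∀ n ∈ S, T ≤ emb r s n ∧ emb r s n ≤ 2 * a * T := by
    intro n hn
    obtain ⟨u, v, h1, h2, h3, h4, he⟩ := hmem n hn
    rw [he]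
    constructor <;> nlinarith
  have b₂ : ∀ n ∈ S, T ≤ emb s t n ∧ emb s t n ≤ 5 * T := by
    intro n hn
    obtain ⟨u, v, h1, h2, h3, h4, he⟩ := hmem n hn
    rw [he]
    constructor <;> nlinarith
  have b₃ : ∀ n ∈ S, T ≤ emb t r n ∧ emb t r n ≤ 5 * T := by
    intro n hn
    obtain ⟨u, v, h1, h2, h3, h4, he⟩ := hmem n hn
    rw [he]
    constructor <;> nlinarith
  have hT0 : (0 : ℝ) < T := by linarith
  have key := hM.card_le_mul_ncard h (S := S) (x := a * Y ^ 3) (C := 2) hT0 hT0 hT0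
    (fun n hn => ⟨(b₁ n hn).1, by exact_mod_cast (b₁ n hn).2⟩)
    (fun n hn => ⟨(b₂ n hn).1, (b₂ n hn).2.trans (by push_cast; nlinarith)⟩)
    (fun n hn => ⟨(b₃ n hn).1, (b₃ n hn).2.trans (by push_cast; nlinarith)⟩)
    (fun n hn => by
      have := hT0.le.trans (b₁ n hn).1
      have := hT0.le.trans (b₂ n hn).1
      have := hT0.le.trans (b₃ n hn).1
      calc _ ≤ (2 * a * T) * (5 * T) * (5 * T) := by
            gcongr
            exacts [(b₁ n hn).2, (b₂ n hn).2, (b₃ n hn).2]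
        _ = 50 * a * (T : ℝ) ^ 3 := by ring
        _ ≤ 50 * a * (Y / 4) ^ 3 := by gcongr
        _ = 50 / 64 * (a * Y ^ 3) := by ring
        _ ≤ a * Y ^ 3 := by
          have : 0 ≤ a * Y ^ 3 := by positivity
          linarith)
  rw [hS] at key
  have key' : (T : ℝ) ^ 2 ≤ 2601 * (principalIdeals K (a * Y ^ 3)).ncard := by
    exact_mod_cast key
  nlinarith

end LowerBound

section LogTerm

open Finset

lemma half_le_card_Icc_ceil_floor {θ Z : ℝ} (hZ : 2 ≤ Z) :
    Z / 2 ≤ #(Icc ⌈Z - θ⌉ ⌊2 * Z - θ⌋) := by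
  rw [Int.card_Icc]
  have h1 := Int.ceil_lt_add_one (Z - θ)
  have h2 := Int.lt_floor_add_one (2 * Z - θ)
  have h3 : ((⌊2 * Z - θ⌋ + 1 - ⌈Z - θ⌉ : ℤ) : ℝ) ≤ (⌊2 * Z - θ⌋ + 1 - ⌈Z - θ⌉).toNat := by
    exact_mod_cast Int.self_le_toNat _
  push_cast at h3
  linarith

lemma exists_finset_bands (I : Finset ℕ) (Z θ : ℕ → ℕ → ℝ)
    (hZ : ∀ v ∈ I, ∀ w ∈ I, 2 ≤ Z v w) :
    ∃ S : Finset (ℤ × ℤ × ℤ), (∀ n ∈ S, ∃ u : ℤ, ∃ v ∈ I, ∃ w ∈ I, n = (u, (v : ℤ), (w : ℤ)) ∧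
      Z v w ≤ u + θ v w ∧ u + θ v w ≤ 2 * Z v w) ∧
      ∑ v ∈ I, ∑ w ∈ I, Z v w / 2 ≤ #S := by
  classical
  let B : ℕ × ℕ → Finset (ℤ × ℤ × ℤ) := fun p =>
    (Icc ⌈Z p.1 p.2 - θ p.1 p.2⌉ ⌊2 * Z p.1 p.2 - θ p.1 p.2⌋).image
      fun u => (u, (p.1 : ℤ), (p.2 : ℤ))
  refine ⟨(I ×ˢ I).biUnion B, ?_, ?_⟩
  · intro n hn
    obtain ⟨⟨v, w⟩, hp, hn⟩ := mem_biUnion.1 hn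
    obtain ⟨u, hu, rfl⟩ := mem_image.1 hn
    obtain ⟨hv, hw⟩ := mem_product.1 hp
    obtain ⟨h1, h2⟩ := mem_Icc.1 hu
    have h1' := Int.ceil_le.1 h1
    have h2' := Int.le_floor.1 h2
    exact ⟨u, v, hv, w, hw, rfl, by linarith, by linarith⟩
  · rw [card_biUnion, ← sum_product']
    · push_cast
      refine sum_le_sum fun p hp => ?_
      obtain ⟨hv, hw⟩ := mem_product.1 hp
      rw [card_image_of_injective _ fun u u' h => (Prod.mk.inj h).1]
      exact half_le_card_Icc_ceil_floor (hZ _ hv _ hw)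
    · intro p _ p' _ hne
      refine disjoint_left.2 fun n hn hn' => hne ?_
      obtain ⟨u, -, rfl⟩ := mem_image.1 hn
      obtain ⟨u', -, h⟩ := mem_image.1 hn'
      simp only [Prod.mk.injEq, Nat.cast_inj] at h
      exact Prod.ext h.2.1.symm h.2.2.symm

lemma log_le_sum_Ico_inv {m V : ℕ} (hm : 1 ≤ m) (hV : 1 ≤ V) :
    Real.log m ≤ ∑ v ∈ Ico V (V * m), (1 / v : ℝ) := by
  have key : ∀ n, V ≤ n → Real.log n - Real.log V ≤ ∑ v ∈ Ico V n, (1 / v : ℝ) := by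
    intro n hn
    induction n, hn using Nat.le_induction with
    | base => simp
    | succ n hn ih =>
      rw [sum_Ico_succ_top hn]
      have hn0 : (0 : ℝ) < n := by exact_mod_cast hV.trans hn
      have h1 := Real.log_le_sub_one_of_pos (x := ((n + 1 : ℕ) : ℝ) / n) (by positivity)
      rw [Real.log_div (by positivity) hn0.ne'] at h1
      have h2 : ((n + 1 : ℕ) : ℝ) / n - 1 = 1 / n := by push_cast; field_simp; ring
      linarith
  have h := key (V * m) (Nat.le_mul_of_pos_right V hm)
  rw [Nat.cast_mul, Real.log_mul (by positivity) (by positivity)] at h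
  linarith

lemma log_le_four_mul_log_floor_sqrt {a : ℝ} (ha : 8 ≤ a) :
    Real.log a ≤ 4 * Real.log ⌊√a⌋₊ := by
  have h1 : (2 : ℝ) ≤ ⌊√a⌋₊ := by
    have : 2 ≤ ⌊√a⌋₊ := Nat.le_floor (Real.le_sqrt_of_sq_le (by norm_num; linarith))
    exact_mod_cast this
  have h2 := Nat.lt_floor_add_one √a
  have h3 := Real.sq_sqrt (show 0 ≤ a by linarith)
  have h4 := Real.sqrt_nonneg a
  generalize (⌊√a⌋₊ : ℝ) = m at *
  calc Real.log a ≤ Real.log (m ^ 4) := by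
        refine Real.log_le_log (by linarith) ?_
        have h5 : √a ≤ m ^ 2 := by nlinarith
        calc a = √a ^ 2 := h3.symm
          _ ≤ (m ^ 2) ^ 2 := by gcongr
          _ = m ^ 4 := by ring
    _ = 4 * Real.log m := by rw [Real.log_pow]; norm_num

variable {a r s t : ℝ} {K : Type*} [Field K] [NumberField K] {Φ : ℤ × ℤ × ℤ → 𝓞 K}
  {e₁ e₂ e₃ : 𝓞 K →+* ℝ}

lemma RootTriple.sub_bounds (h : RootTriple a r s t) {v w : ℝ} (hv : 0 ≤ v) (hw : 0 ≤ w)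
    (hwv : 2 * w ≤ a * v) (hvw : 2 * v ≤ a * w) :
    a * v ≤ v * (r - s) + w * (s - t) ∧ v * (r - s) + w * (s - t) ≤ 2 * a * v ∧
      a * w / 4 ≤ w * (r - t) - v * (s - t) ∧ w * (r - t) - v * (s - t) ≤ 2 * a * w := by
  have ha := h.eight_le
  have hr := h.lt_r
  have hr' := h.r_lt
  have hs := h.s_neg
  have hs' := h.neg_s_lt
  have ht := h.t_lt
  have ht' := h.lt_t
  have hst := h.one_lt_s_sub_t
  have hst' : s - t ≤ 103 / 100 := by
    have := h.s_sub_t_mul_lt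
    nlinarith
  refine ⟨?_, ?_, ?_, ?_⟩
  · nlinarith
  · have h1 : w * (s - t) ≤ w * (103 / 100) := by gcongr
    have h2 : v * (r - s) ≤ v * (a + 21 / 10) := by gcongr; linarith
    have h3 : 8 * v ≤ a * v := by gcongr
    nlinarith
  · have h1 : v * (s - t) ≤ v * (103 / 100) := by gcongr
    have h2 : w * (a + 2) ≤ w * (r - t) := by gcongr; linarith
    nlinarith
  · have h1 : 0 ≤ v * (s - t) := by apply mul_nonneg <;> linarith
    have h2 : w * (r - t) ≤ w * (a + 4) := by gcongr; linarith
    nlinarith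

lemma IsModel.log_sq_le_ncard (hM : IsModel r s t Φ e₁ e₂ e₃) (h : RootTriple a r s t) {y : ℝ}
    (hy : 256 * a ≤ y) :
    Real.log a ^ 2 * y ^ 3 / a ^ 2 ≤ 1024 * 38025 * (principalIdeals K (y ^ 3)).ncard := by
  have ha := h.eight_le
  have ha0 : 0 < a := by linarith
  have hy0 : 0 < y := by linarith
  set m := ⌊√a⌋₊ with hm
  have hm2 : 2 ≤ m := Nat.le_floor (Real.le_sqrt_of_sq_le (by norm_num; linarith))
  have hm2' : (2 : ℝ) ≤ m := by exact_mod_cast hm2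
  have hma : (m : ℝ) ^ 2 ≤ a := by
    calc (m : ℝ) ^ 2 ≤ √a ^ 2 := by gcongr; exact Nat.floor_le (Real.sqrt_nonneg a)
      _ = a := Real.sq_sqrt ha0.le
  have hma' : 2 * (m : ℝ) ≤ a := by nlinarith
  set V := ⌈y / a⌉₊ with hV
  have hyV : y / a ≤ V := Nat.le_ceil _
  have hya : 256 ≤ y / a := by rwa [le_div_iff₀ ha0]
  have hVy : (V : ℝ) ≤ 2 * (y / a) := by
    linarith [Nat.ceil_lt_add_one (show 0 ≤ y / a by positivity)]
  have hV0 : (0 : ℝ) < V := by linarith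
  have hV1 : 1 ≤ V := by exact_mod_cast hV0
  have hyV' : y ≤ a * V := by rwa [div_le_iff₀' ha0] at hyV
  have haV : a * V ≤ 2 * y := by
    calc a * V ≤ a * (2 * (y / a)) := by gcongr
      _ = 2 * y := by field_simp
  set I := Ico V (V * m) with hI
  have hmem : ∀ v ∈ I, (V : ℝ) ≤ v ∧ (v : ℝ) ≤ V * m := fun v hv => by
    obtain ⟨h1, h2⟩ := mem_Ico.1 hv
    exact ⟨by exact_mod_cast h1, by exact_mod_cast h2.le⟩
  let Z : ℕ → ℕ → ℝ := fun v w => y ^ 3 / (32 * a ^ 2 * v * w)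
  have hZ : ∀ v ∈ I, ∀ w ∈ I, y ^ 3 / (32 * a ^ 2 * (V * m) ^ 2) ≤ Z v w ∧
      Z v w ≤ y ^ 3 / (32 * a ^ 2 * V ^ 2) := by
    intro v hv w hw
    obtain ⟨hv1, hv2⟩ := hmem v hv
    obtain ⟨hw1, hw2⟩ := hmem w hw
    have := hV0.trans_le hv1
    have := hV0.trans_le hw1
    simp only [Z]
    constructor
    · refine div_le_div_of_nonneg_left (by positivity) (by positivity) ?_
      calc 32 * a ^ 2 * v * w ≤ 32 * a ^ 2 * (V * m) * (V * m) := by gcongr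
        _ = _ := by ring
    · refine div_le_div_of_nonneg_left (by positivity) (by positivity) ?_
      calc 32 * a ^ 2 * (V : ℝ) ^ 2 = 32 * a ^ 2 * V * V := by ring
        _ ≤ _ := by gcongr
  have hZ2 : 2 ≤ y ^ 3 / (32 * a ^ 2 * (V * m) ^ 2) := by
    rw [le_div_iff₀ (by positivity)]
    calc 2 * (32 * a ^ 2 * (V * m) ^ 2) = 64 * (a * V) ^ 2 * (m : ℝ) ^ 2 := by ring
      _ ≤ 64 * (2 * y) ^ 2 * a := by gcongr
      _ = y ^ 2 * (256 * a) := by ring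
      _ ≤ y ^ 2 * y := by gcongr
      _ = y ^ 3 := by ring
  obtain ⟨S, hS, hScard⟩ := exists_finset_bands I Z (fun v w => v * s + w * t)
    fun v hv w hw => hZ2.trans (hZ v hv w hw).1
  have hbound : ∀ n ∈ S, ∃ v ∈ I, ∃ w ∈ I, (Z v w ≤ emb s t n ∧ emb s t n ≤ 2 * Z v w) ∧
      (a * v ≤ emb r s n ∧ emb r s n ≤ 4 * a * v) ∧
      (a * w / 4 ≤ emb t r n ∧ emb t r n ≤ 4 * a * w) := by
    intro n hn
    obtain ⟨u, v, hv, w, hw, rfl, h1, h2⟩ := hS n hn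
    obtain ⟨hv1, hv2⟩ := hmem v hv
    obtain ⟨hw1, hw2⟩ := hmem w hw
    have hv0 := hV0.trans_le hv1
    have hw0 := hV0.trans_le hw1
    obtain ⟨b1, b2, b3, b4⟩ := h.sub_bounds hv0.le hw0.le (by nlinarith) (by nlinarith)
    have e1 := emb_one_sub_emb_two (r := r) (s := s) (t := t) (u, (v : ℤ), (w : ℤ))
    have e3 := emb_three_sub_emb_two (r := r) (s := s) (t := t) (u, (v : ℤ), (w : ℤ))
    have e2 : emb s t (u, (v : ℤ), (w : ℤ)) = u + (v * s + w * t) := by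
      simp only [emb]; push_cast; ring
    simp only [Int.cast_natCast] at e1 e3
    have hZpos := hZ2.trans (hZ v hv w hw).1
    have hZV : Z v w ≤ a * V := by
      refine (hZ v hv w hw).2.trans ?_
      rw [div_le_iff₀ (by positivity)]
      calc y ^ 3 ≤ (a * V) ^ 3 := by gcongr
        _ ≤ 32 * (a * V) ^ 3 := by
          have : 0 ≤ (a * V) ^ 3 := by positivity
          linarith
        _ = _ * (32 * a ^ 2 * V ^ 2) := by ring
    have hZv : Z v w ≤ a * v := hZV.trans (by gcongr)
    have hZw : Z v w ≤ a * w := hZV.trans (by gcongr)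
    exact ⟨v, hv, w, hw, ⟨by linarith, by linarith⟩, ⟨by linarith, by linarith⟩,
      ⟨by linarith, by linarith⟩⟩
  have hcard := hM.card_le_mul_ncard h (S := S) (x := y ^ 3) (C := 8) (l₁ := a * V)
    (l₂ := y ^ 3 / (32 * a ^ 2 * (V * m) ^ 2)) (l₃ := a * V / 4) (by positivity) (by positivity)
    (by positivity)
    (fun n hn => by
      obtain ⟨v, hv, w, hw, b2, b1, b3⟩ := hbound n hn
      have h1 := (hmem v hv).1
      refine ⟨le_trans (by gcongr) b1.1, b1.2.trans ?_⟩
      push_cast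
      calc 4 * a * v ≤ 4 * a * (V * m) := by gcongr; exact (hmem v hv).2
        _ = 4 * a * V * m := by ring
        _ ≤ 4 * a * V * (2 * a) := by gcongr; linarith
        _ = _ := by ring)
    (fun n hn => by
      obtain ⟨v, hv, w, hw, b2, b1, b3⟩ := hbound n hn
      refine ⟨(hZ v hv w hw).1.trans b2.1, b2.2.trans ?_⟩
      push_cast
      have h1 := (hZ v hv w hw).2
      have h2 : y ^ 3 / (32 * a ^ 2 * V ^ 2) =
          (m : ℝ) ^ 2 * (y ^ 3 / (32 * a ^ 2 * (V * m) ^ 2)) := by field_simp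
      have h3 : (m : ℝ) ^ 2 * (y ^ 3 / (32 * a ^ 2 * (V * m) ^ 2)) ≤
        a * (y ^ 3 / (32 * a ^ 2 * (V * m) ^ 2)) := by gcongr
      have h4 : 0 ≤ a * (y ^ 3 / (32 * a ^ 2 * (V * m) ^ 2)) := by positivity
      linarith)
    (fun n hn => by
      obtain ⟨v, hv, w, hw, b2, b1, b3⟩ := hbound n hn
      have h1 := (hmem w hw).1
      refine ⟨le_trans (by gcongr) b3.1, b3.2.trans ?_⟩
      push_cast
      calc 4 * a * w ≤ 4 * a * (V * m) := by gcongr; exact (hmem w hw).2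
        _ = 2 * a * V * (2 * m) := by ring
        _ ≤ 2 * a * V * a := by gcongr
        _ = _ := by ring)
    (fun n hn => by
      obtain ⟨v, hv, w, hw, b2, b1, b3⟩ := hbound n hn
      have hv0 := hV0.trans_le (hmem v hv).1
      have hw0 := hV0.trans_le (hmem w hw).1
      have p2 : 0 ≤ emb s t n := le_trans (by simp only [Z]; positivity) b2.1
      have p3 : 0 ≤ emb t r n := le_trans (by positivity) b3.1
      calc _ ≤ (4 * a * v) * (2 * Z v w) * (4 * a * w) := by
            gcongr
            exacts [b1.2, b2.2, b3.2]
        _ = y ^ 3 := by simp only [Z]; field_simp; norm_num)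
  have hcard' : (#S : ℝ) ≤ 38025 * (principalIdeals K (y ^ 3)).ncard := by exact_mod_cast hcard
  have hsum : ∑ v ∈ I, ∑ w ∈ I, Z v w / 2 =
      y ^ 3 / (64 * a ^ 2) * (∑ v ∈ I, (1 / v : ℝ)) ^ 2 := by
    rw [pow_two (∑ v ∈ I, (1 / v : ℝ)), sum_mul_sum, mul_sum]
    refine sum_congr rfl fun v hv => ?_
    rw [mul_sum]
    refine sum_congr rfl fun w hw => ?_
    have hv0 := hV0.trans_le (hmem v hv).1
    have hw0 := hV0.trans_le (hmem w hw).1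
    simp only [Z]
    field_simp
    norm_num
  have hlog : Real.log a / 4 ≤ ∑ v ∈ I, (1 / v : ℝ) := by
    have h1 := log_le_sum_Ico_inv (m := m) (by omega) hV1
    have h2 := log_le_four_mul_log_floor_sqrt ha
    linarith
  have hlog0 : 0 ≤ Real.log a := Real.log_nonneg (by linarith)
  have hfinal : Real.log a ^ 2 * y ^ 3 / a ^ 2 / 1024 ≤ ∑ v ∈ I, ∑ w ∈ I, Z v w / 2 := by
    rw [hsum]
    calc _ = y ^ 3 / (64 * a ^ 2) * (Real.log a / 4) ^ 2 := by ring
      _ ≤ _ := by gcongr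
  linarith

lemma IsModel.le_mul_ncard (hM : IsModel r s t Φ e₁ e₂ e₃) (h : RootTriple a r s t) {y Y : ℝ}
    (hy : 1 ≤ y) (hY : 0 < Y) (hYy : Y ^ 3 = y ^ 3 / a) :
    Real.log a ^ 2 * y ^ 3 / a ^ 2 + Y ^ 2 + y ≤
      9217 * 166466 * (principalIdeals K (y ^ 3)).ncard := by
  have ha := h.eight_le
  have ha0 : 0 < a := by linarith
  have h1 := hM.le_ncard hy
  have hxY : y ^ 3 = a * Y ^ 3 := by rw [hYy]; field_simp
  have h2 : Y ^ 2 ≤ 166464 * (principalIdeals K (y ^ 3)).ncard := by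
    rcases le_or_gt 4 Y with h4 | h4
    · rw [hxY]
      exact hM.sq_le_ncard h h4
    · nlinarith
  have h3 : Real.log a ^ 2 * y ^ 3 / a ^ 2 ≤
      9216 * 166464 * (principalIdeals K (y ^ 3)).ncard := by
    rcases le_or_gt (256 * a) y with h4 | h4
    · linarith [hM.log_sq_le_ncard h h4]
    · obtain ⟨b, hb, hba⟩ : ∃ b : ℝ, 0 < b ∧ b ^ 6 = a := by
        refine ⟨a ^ ((1 : ℝ) / 6), by positivity, ?_⟩
        rw [← Real.rpow_natCast, ← Real.rpow_mul ha0.le]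
        norm_num
      have hlog : Real.log a ≤ 6 * b := by
        rw [← hba, Real.log_pow]
        have := Real.log_le_sub_one_of_pos hb
        push_cast
        linarith
      have hlog0 : 0 ≤ Real.log a := Real.log_nonneg (by linarith)
      have hyY : y = b ^ 2 * Y := by
        refine (pow_left_inj₀ (by linarith) (by positivity) three_ne_zero).1 ?_
        rw [hxY, ← hba]
        ring
      calc Real.log a ^ 2 * y ^ 3 / a ^ 2 = Real.log a ^ 2 * y ^ 2 / a ^ 2 * y := by ring
        _ ≤ (6 * b) ^ 2 * y ^ 2 / a ^ 2 * (256 * a) := by gcongr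
        _ = 9216 * Y ^ 2 := by rw [hyY, ← hba]; field_simp; norm_num
        _ ≤ _ := by linarith
  have : (0 : ℝ) ≤ (principalIdeals K (y ^ 3)).ncard := Nat.cast_nonneg _
  linarith

end LogTerm

end SimplestCubic

theorem stmt_0 :
    ∃ c₁ c₂ : ℝ, 0 < c₁ ∧ 0 < c₂ ∧
      ∀ (a : ℤ), 8 ≤ a →
      ∀ (K : Type) [Field K] [NumberField K] (σ : K →+* ℝ) (ρK : K),
        σ ρK = simplestCubicRoot a →
        IntermediateField.adjoin ℚ {ρK} = ⊤ →
        Algebra.adjoin ℤ {ρK} = integralClosure ℤ K →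
        ∀ x : ℝ, 1 ≤ x →
          c₁ * ((Real.log a) ^ 2 * x / (a : ℝ) ^ 2 + (x / a) ^ ((2 : ℝ) / 3)
              + x ^ ((1 : ℝ) / 3)) ≤
            (Set.ncard {I : Ideal (RingOfIntegers K) |
                I ≠ ⊥ ∧ Submodule.IsPrincipal I ∧ (Ideal.absNorm I : ℝ) ≤ x} : ℝ) ∧
          (Set.ncard {I : Ideal (RingOfIntegers K) |
                I ≠ ⊥ ∧ Submodule.IsPrincipal I ∧ (Ideal.absNorm I : ℝ) ≤ x} : ℝ) ≤
            c₂ * ((Real.log a) ^ 2 * x / (a : ℝ) ^ 2 + (x / a) ^ ((2 : ℝ) / 3)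
              + x ^ ((1 : ℝ) / 3)) := by
  refine ⟨(9217 * 166466)⁻¹, 3840, by norm_num, by norm_num, ?_⟩
  intro a ha K _ _ σ ρK hσ htop hmono x hx
  have h := SimplestCubic.rootTriple_simplestCubicRoot ha
  obtain ⟨Φ, e₁, e₂, e₃, hM⟩ := SimplestCubic.exists_isModel ha h hσ htop hmono
  have ha0 : (0 : ℝ) < a := by linarith [h.eight_le]
  have hx0 : 0 ≤ x := by linarith
  have hy : 1 ≤ x ^ ((1 : ℝ) / 3) := Real.one_le_rpow hx (by norm_num)
  have hyx : (x ^ ((1 : ℝ) / 3)) ^ 3 = x := by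
    rw [← Real.rpow_natCast, ← Real.rpow_mul hx0]
    norm_num
  have hY : 0 < (x / a) ^ ((1 : ℝ) / 3) := by positivity
  have hYx : ((x / a) ^ ((1 : ℝ) / 3)) ^ 3 = x / a := by
    rw [← Real.rpow_natCast, ← Real.rpow_mul (by positivity)]
    norm_num
  have hYsq : (x / a) ^ ((2 : ℝ) / 3) = ((x / a) ^ ((1 : ℝ) / 3)) ^ 2 := by
    rw [← Real.rpow_natCast, ← Real.rpow_mul (by positivity)]
    norm_num
  have hYy : ((x / a) ^ ((1 : ℝ) / 3)) ^ 3 = (x ^ ((1 : ℝ) / 3)) ^ 3 / a := by rw [hYx, hyx]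
  rw [hYsq]
  constructor
  · have hlow := hM.le_mul_ncard h hy hY hYy
    rw [hyx] at hlow
    rw [inv_mul_le_iff₀ (by norm_num)]
    exact hlow
  · obtain ⟨W, hW, hWcard⟩ := SimplestCubic.exists_finset_region h.eight_le hy hY hYy
    rw [hyx] at hW hWcard
    have hupp : ((SimplestCubic.principalIdeals K x).ncard : ℝ) ≤ 24 * W.card := by
      exact_mod_cast hM.ncard_principalIdeals_le h hW
    refine hupp.trans ?_
    have hYsq0 := sq_nonneg ((x / a) ^ ((1 : ℝ) / 3))
    linarith
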